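/- arXiv:2403.16636 — 7 statements merged into one kernel-verified Lean document; each statement's English description precedes it below -/
import Mathlib

section
/- Let Φ : ℂ² ⇢ ℂⁿ be a rational map whose components are quotients of bivariate polynomials over ℂ, and assume Φ is birational: there exist rational functions Ψ₁, Ψ₂ (quotients of polynomials in n variables over ℂ) and a nonzero polynomial R ∈ ℂ[x₁,x₂] such that (Ψ₁(Φ(q)), Ψ₂(Φ(q))) = q whenever R(q) ≠ 0 (all denominators being nonzero there). Let ξ be meromorphic on ℂ and not algebraic (there is no nonzero polynomial Q ∈ ℂ[x,y] with Q(z, ξ(z)) = 0 for all z where ξ is analytic), and define p(z) := Φ(z, ξ(z)). Then there exists a closed set E ⊂ ℂ with no accumulation point in ℂ such that for every z ∉ E: ξ is analytic at z, all relevant denominators are nonzero, and (Ψ₁(p(z)), Ψ₂(p(z))) = (z, ξ(z)). In particular, p is injective on ℂ ∖ E and the rational function w ↦ Ψ₁(w) is an inverse of p there, so p admits a rational inverse. -/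
open MvPolynomial

/-- A polynomial evaluated along the graph of a meromorphic function is meromorphic. -/
theorem MeromorphicAt.eval_mvPolynomial_graph {ξ : ℂ → ℂ} {z : ℂ} (h : MeromorphicAt ξ z)
    (Q : MvPolynomial (Fin 2) ℂ) : MeromorphicAt (fun w ↦ eval ![w, ξ w] Q) z := by
  induction Q using MvPolynomial.induction_on with
  | C a => simp
  | add P Q hP hQ => simpa using hP.fun_add hQ
  | mul_X P i hP =>
    have hi : MeromorphicAt (fun w ↦ ![w, ξ w] i) z := by
      fin_cases i
      · exact MeromorphicAt.id z
      · simpa using h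
    simpa using hP.fun_mul hi

/-- A polynomial evaluated along the graph of an analytic function is analytic. -/
theorem AnalyticAt.eval_mvPolynomial_graph {ξ : ℂ → ℂ} {z : ℂ} (h : AnalyticAt ℂ ξ z)
    (Q : MvPolynomial (Fin 2) ℂ) : AnalyticAt ℂ (fun w ↦ eval ![w, ξ w] Q) z := by
  have hi : ∀ i, AnalyticAt ℂ (fun w ↦ ![w, ξ w] i) z := by
    intro i
    fin_cases i
    · exact analyticAt_id
    · simpa using h
  simpa [MvPolynomial.coe_aeval_eq_eval] using AnalyticAt.aeval_mvPolynomial hi Q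

/-- Corollary `prop`: if `Φ : ℂ² ⇢ ℂⁿ` is birational and `ξ` is
meromorphic on `ℂ` and not algebraic, then `p(z) := Φ(z, ξ(z))` is invertible over its
image off a closed set without accumulation points, with rational inverse. -/
theorem meromorphic_graph_parametrization_has_rational_inverse (n : ℕ)
    (A B : Fin n → MvPolynomial (Fin 2) ℂ) (hB : ∀ j, B j ≠ 0)
    (Φ : (Fin 2 → ℂ) → (Fin n → ℂ))
    (hΦ : ∀ q j, Φ q j = eval q (A j) / eval q (B j))
    (C D : Fin 2 → MvPolynomial (Fin n) ℂ)
    (R : MvPolynomial (Fin 2) ℂ) (hR : R ≠ 0)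
    (hbir : ∀ q : Fin 2 → ℂ, eval q R ≠ 0 →
      (∀ j, eval q (B j) ≠ 0) ∧ (∀ i, eval (Φ q) (D i) ≠ 0) ∧
      (∀ i, eval (Φ q) (C i) / eval (Φ q) (D i) = q i))
    (ξ : ℂ → ℂ) (hmero : MeromorphicOn ξ Set.univ)
    (halg : ¬ ∃ Q : MvPolynomial (Fin 2) ℂ, Q ≠ 0 ∧
      ∀ z : ℂ, AnalyticAt ℂ ξ z → eval ![z, ξ z] Q = 0)
    (p : ℂ → (Fin n → ℂ)) (hp : ∀ z, p z = Φ ![z, ξ z]) :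
    ∃ E : Set ℂ, IsClosed E ∧ (∀ w : ℂ, ¬ AccPt w (Filter.principal E)) ∧
      (∀ z ∉ E, AnalyticAt ℂ ξ z ∧
        (∀ j, eval ![z, ξ z] (B j) ≠ 0) ∧
        (∀ i, eval (p z) (D i) ≠ 0) ∧
        (∀ i, eval (p z) (C i) / eval (p z) (D i) = ![z, ξ z] i)) ∧
      Set.InjOn p Eᶜ := by
  set f : ℂ → ℂ := fun z ↦ eval ![z, ξ z] R
  have hf : MeromorphicOn f Set.univ := fun z hz ↦ (hmero z hz).eval_mvPolynomial_graph R
  obtain ⟨z₀, hz₀, hfz₀⟩ : ∃ z, AnalyticAt ℂ ξ z ∧ f z ≠ 0 := by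
    by_contra! h
    exact halg ⟨R, hR, h⟩
  have hord₀ : meromorphicOrderAt f z₀ ≠ ⊤ :=
    (meromorphicOrderAt_ne_top_iff_eventually_ne_zero (hf z₀ trivial)).2
      (((hz₀.eval_mvPolynomial_graph R).continuousAt.eventually_ne hfz₀).filter_mono
        nhdsWithin_le_nhds)
  have hord : ∀ z ∈ Set.univ, meromorphicOrderAt f z ≠ ⊤ := fun z hz ↦
    hf.meromorphicOrderAt_ne_top_of_isPreconnected isPreconnected_univ trivial hz hord₀
  have hcod : {z | AnalyticAt ℂ ξ z ∧ f z ≠ 0} ∈ Filter.codiscrete ℂ := by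
    filter_upwards [hmero.analyticAt_mem_codiscreteWithin,
      hf.eventually_codiscreteWithin_apply_ne_zero hord] with z h₁ h₂
    exact ⟨h₁, h₂⟩
  have hinv : ∀ z ∉ {z | AnalyticAt ℂ ξ z ∧ f z ≠ 0}ᶜ, AnalyticAt ℂ ξ z ∧
      (∀ j, eval ![z, ξ z] (B j) ≠ 0) ∧ (∀ i, eval (p z) (D i) ≠ 0) ∧
      (∀ i, eval (p z) (C i) / eval (p z) (D i) = ![z, ξ z] i) := by
    intro z hz
    obtain ⟨hz₁, hz₂⟩ := Set.notMem_compl_iff.1 hz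
    rw [hp]
    exact ⟨hz₁, hbir _ hz₂⟩
  refine ⟨_, (mem_codiscrete'.1 hcod).1.isClosed_compl, mem_codiscrete_accPt.1 hcod, hinv, ?_⟩
  intro z hz w hw hzw
  have h₁ := (hinv z hz).2.2.2 0
  have h₂ := (hinv w hw).2.2.2 0
  rw [hzw] at h₁
  simpa using h₁.symm.trans h₂
end

section
/- Let p, q : ℂ ⇢ ℂⁿ have all components meromorphic on ℂ, and let C₁ and C₂ denote the images of p and q (over the points where they are analytic). Assume p and q admit rational inverses: there exist rational functions P, Q : ℂⁿ ⇢ ℂ (quotients of polynomials in n variables over ℂ) and closed sets E_p, E_q ⊂ ℂ with no accumulation points such that P(p(z)) = z for all z ∉ E_p and Q(q(z)) = z for all z ∉ E_q (with all denominators nonzero there). Let f(x) = Ax + b with A an invertible n×n complex matrix and b ∈ ℂⁿ, and suppose f(C₁) = C₂. Then there exist α, β, γ, δ ∈ ℂ with αδ − βγ ≠ 0 such that f(p(z)) = q((αz + β)/(γz + δ)) for all z outside a closed set with no accumulation point in ℂ. -/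
open MvPolynomial Filter Topology

theorem MeromorphicAt.eval_mvPolynomial {σ : Type*} {p : ℂ → σ → ℂ} {z : ℂ}
    (hp : ∀ i, MeromorphicAt (fun w => p w i) z) (P : MvPolynomial σ ℂ) :
    MeromorphicAt (fun w => eval (p w) P) z := by
  induction P using MvPolynomial.induction_on with
  | C a => simp
  | add P Q hP hQ => simpa using hP.fun_add hQ
  | mul_X P i hP => simpa using hP.fun_mul (hp i)

theorem AnalyticAt.eval_mvPolynomial {σ : Type*} {p : ℂ → σ → ℂ} {z : ℂ}
    (hp : ∀ i, AnalyticAt ℂ (fun w => p w i) z) (P : MvPolynomial σ ℂ) :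
    AnalyticAt ℂ (fun w => eval (p w) P) z := by
  simpa using AnalyticAt.aeval_mvPolynomial hp P

theorem mem_nhdsNE_of_mem_codiscrete {X : Type*} [TopologicalSpace X] {U : Set X}
    (hU : U ∈ codiscrete X) (x : X) : U ∈ 𝓝[≠] x := by
  rw [← compl_compl U]
  exact disjoint_principal_right.1 (mem_codiscrete.1 hU x)

theorem countable_compl_of_mem_codiscrete {X : Type*} [TopologicalSpace X]
    [SecondCountableTopology X] {U : Set X} (hU : U ∈ codiscrete X) : Uᶜ.Countable :=
  (HereditarilyLindelofSpace.isLindelof Uᶜ).countable_of_isDiscrete (mem_codiscrete'.1 hU).2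

/-- An entire function of at most linear growth is affine. -/
theorem Differentiable.exists_eq_affine_of_norm_le {H : ℂ → ℂ} (hH : Differentiable ℂ H)
    {C : ℝ} {z₀ : ℂ} (hb : ∀ z, ‖H z‖ ≤ C * (1 + ‖z - z₀‖)) :
    ∃ a c : ℂ, ∀ z, H z = a * z + c := by
  have hG : Differentiable ℂ (dslope H z₀) := by
    have := (Complex.differentiableOn_dslope (f := H) (c := z₀) univ_mem).2 hH.differentiableOn
    exact differentiableOn_univ.1 this
  obtain ⟨K, hK⟩ := (isCompact_closedBall z₀ 1).exists_bound_of_continuousOn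
    hG.continuous.continuousOn
  have hbd : ∀ z, ‖dslope H z₀ z‖ ≤ max K (3 * C) := by
    intro z
    by_cases hz : z ∈ Metric.closedBall z₀ 1
    · exact (hK z hz).trans (le_max_left _ _)
    · have hr : 1 < ‖z - z₀‖ := by simpa [dist_eq_norm] using hz
      have hne : z ≠ z₀ := by rintro rfl; simp at hr; linarith
      refine le_trans ?_ (le_max_right _ _)
      rw [dslope_of_ne _ hne, slope_def_field, norm_div, div_le_iff₀ (by linarith)]
      have h0 := hb z₀
      simp only [sub_self, norm_zero, add_zero, mul_one] at h0
      have hC : 0 ≤ C := (norm_nonneg _).trans h0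
      nlinarith [norm_sub_le (H z) (H z₀), hb z]
  obtain ⟨a, ha⟩ := hG.exists_const_forall_eq_of_bounded
    (isBounded_iff_forall_norm_le.2 ⟨_, by rintro _ ⟨z, rfl⟩; exact hbd z⟩)
  refine ⟨a, H z₀ - a * z₀, fun z => ?_⟩
  have := sub_smul_dslope H z₀ z
  rw [ha z, smul_eq_mul] at this
  linear_combination -this

/-- A meromorphic function which is dominated by a continuous function off a closed discrete set
extends to an entire function. -/
theorem MeromorphicOn.exists_differentiable_eqOn {h : ℂ → ℂ} (hh : MeromorphicOn h Set.univ)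
    {U : Set ℂ} (hU : U ∈ codiscrete ℂ) (hc : ∀ z ∈ U, ContinuousAt h z)
    {B : ℂ → ℝ} (hB : Continuous B) (hb : ∀ z ∈ U, ‖h z‖ ≤ B z) :
    ∃ H : ℂ → ℂ, Differentiable ℂ H ∧ Set.EqOn H h U ∧ ∀ z, ‖H z‖ ≤ B z := by
  have heq (x : ℂ) := hh.toMeromorphicNFOn_eq_self_on_nhdsNE (Set.mem_univ x)
  have han (x : ℂ) : AnalyticAt ℂ (toMeromorphicNFOn h Set.univ) x := by
    refine (meromorphicNFOn_toMeromorphicNFOn h Set.univ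
      (Set.mem_univ x)).meromorphicOrderAt_nonneg_iff_analyticAt.1 ?_
    rw [meromorphicOrderAt_congr (heq x)]
    by_contra! hlt
    have ht := (tendsto_cobounded_iff_meromorphicOrderAt_neg (hh x (Set.mem_univ x))).2 hlt
    have h1 := (tendsto_norm_atTop_iff_cobounded.2 ht).eventually_gt_atTop (B x + 1)
    have h2 : ∀ᶠ z in 𝓝[≠] x, B z < B x + 1 :=
      (hB.continuousAt.eventually_lt_const (by linarith)).filter_mono nhdsWithin_le_nhds
    obtain ⟨z, hz1, hz2, hz3⟩ :=
      (h1.and (h2.and (mem_nhdsNE_of_mem_codiscrete hU x))).exists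
    linarith [hb z hz3]
  refine ⟨_, fun x => (han x).differentiableAt, fun x hx => ?_, fun x => ?_⟩
  · exact (((han x).continuousAt.eventuallyEq_nhds_iff_eventuallyEq_nhdsNE (hc x hx)).1
      (heq x)).eq_of_nhds
  · refine le_of_tendsto_of_tendsto (b := 𝓝[≠] x)
      ((han x).continuousAt.norm.mono_left nhdsWithin_le_nhds)
      (hB.continuousAt.mono_left nhdsWithin_le_nhds) ?_
    filter_upwards [heq x, mem_nhdsNE_of_mem_codiscrete hU x] with z hz hzU
    rw [hz]
    exact hb z hzU

/-- A meromorphic function which is injective off a closed discrete set is a Möbius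
transformation. -/
theorem MeromorphicOn.exists_moebius_of_injOn {φ : ℂ → ℂ} (hφ : MeromorphicOn φ Set.univ)
    {U : Set ℂ} (hU : U ∈ codiscrete ℂ) (han : ∀ z ∈ U, AnalyticAt ℂ φ z)
    (hinj : Set.InjOn φ U) {z₀ : ℂ} (hz₀ : z₀ ∈ U) (hd : deriv φ z₀ ≠ 0) :
    ∃ α β γ δ : ℂ, α * δ - β * γ ≠ 0 ∧
      ∀ z ∈ U \ {z₀}, φ z = (α * z + β) / (γ * z + δ) := by
  have hV : U \ {z₀} ∈ codiscrete ℂ :=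
    inter_mem hU (Set.finite_singleton z₀).compl_mem_codiscrete
  have hne : ∀ z ∈ U \ {z₀}, φ z - φ z₀ ≠ 0 := fun z hz h =>
    hz.2 (hinj hz.1 hz₀ (sub_eq_zero.1 h))
  set h : ℂ → ℂ := fun z => (z - z₀) / (φ z - φ z₀) with hh_def
  have hh : MeromorphicOn h Set.univ := fun z hz =>
    ((MeromorphicAt.id z).fun_sub (.const z₀ z)).fun_div ((hφ z hz).fun_sub (.const _ z))
  have hhc : ∀ z ∈ U \ {z₀}, ContinuousAt h z := fun z hz =>
    ContinuousAt.div (by fun_prop) ((han z hz.1).continuousAt.sub continuousAt_const) (hne z hz)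
  have hlim : Tendsto h (𝓝[≠] z₀) (𝓝 (deriv φ z₀)⁻¹) := by
    have := ((han z₀ hz₀).differentiableAt.hasDerivAt.tendsto_slope).inv₀ hd
    refine this.congr fun z => ?_
    rw [slope_def_field, inv_div]
  have hev : ∀ᶠ z in 𝓝 z₀, z ≠ z₀ → ‖h z‖ < ‖(deriv φ z₀)⁻¹‖ + 1 :=
    eventually_nhdsWithin_iff.1 (hlim.norm.eventually_lt_const (by linarith))
  set W : Set ℂ := {z | z ∈ U ∧ (z ≠ z₀ → ‖h z‖ < ‖(deriv φ z₀)⁻¹‖ + 1)}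
  have hW : W ∈ 𝓝 z₀ := inter_mem ((mem_codiscrete'.1 hU).1.mem_nhds hz₀) hev
  have himg : φ '' W ∈ 𝓝 (φ z₀) := by
    rw [← (han z₀ hz₀).hasStrictDerivAt.map_nhds_eq hd]
    exact image_mem_map hW
  obtain ⟨r, hr, hball⟩ := Metric.mem_nhds_iff.1 himg
  set K := ‖(deriv φ z₀)⁻¹‖ + 1
  have hK : 0 < K := by positivity
  obtain ⟨H, hHd, hHeq, hHb⟩ := hh.exists_differentiable_eqOn hV hhc
    (B := fun z => (K + 1 / r) * (1 + ‖z - z₀‖)) (by fun_prop) (by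
      intro z hz
      have hr' : 0 < 1 / r := by positivity
      have hn := norm_nonneg (z - z₀)
      by_cases hzW : z ∈ W
      · have := hzW.2 hz.2
        nlinarith [mul_nonneg hK.le hn, mul_nonneg hr'.le hn]
      · have hfar : r ≤ ‖φ z - φ z₀‖ := by
          by_contra! hlt
          obtain ⟨w, hw, hwz⟩ := hball (mem_ball_iff_norm.2 hlt)
          exact hzW (hinj hw.1 hz.1 hwz ▸ hw)
        have : ‖h z‖ ≤ 1 / r * ‖z - z₀‖ := by
          rw [hh_def, norm_div, div_eq_mul_one_div, mul_comm]
          gcongr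
        nlinarith [mul_nonneg hK.le hn, mul_nonneg hr'.le hn])
  obtain ⟨a, c, hac⟩ := hHd.exists_eq_affine_of_norm_le hHb
  have hden : ∀ z ∈ U \ {z₀}, (a * z + c) * (φ z - φ z₀) = z - z₀ := fun z hz => by
    rw [← hac z, hHeq hz, hh_def, div_mul_cancel₀ _ (hne z hz)]
  have hden0 : ∀ z ∈ U \ {z₀}, a * z + c ≠ 0 := fun z hz h0 => by
    have := hden z hz
    rw [h0, zero_mul] at this
    exact hz.2 (sub_eq_zero.1 this.symm)
  refine ⟨φ z₀ * a + 1, φ z₀ * c - z₀, a, c, fun hdet => ?_, fun z hz => ?_⟩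
  · have hc0 : c = -(a * z₀) := by linear_combination hdet
    have hcst : ∀ z ∈ U \ {z₀}, a * (φ z - φ z₀) = 1 := fun z hz => by
      have hzz : z - z₀ ≠ 0 := sub_ne_zero.2 hz.2
      apply mul_left_cancel₀ hzz
      rw [mul_one]
      nth_rw 2 [← hden z hz]
      rw [hc0]
      ring
    obtain ⟨z₁, hz₁⟩ := nonempty_of_mem (mem_nhdsNE_of_mem_codiscrete hV 0)
    obtain ⟨z₂, hz₂, hz₂'⟩ := nonempty_of_mem
      (inter_mem (mem_nhdsNE_of_mem_codiscrete hV z₁) self_mem_nhdsWithin)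
    have ha : a ≠ 0 := by
      rintro rfl
      simpa using hcst z₁ hz₁
    refine hz₂' (hinj hz₂.1 hz₁.1 ?_)
    have := mul_left_cancel₀ ha ((hcst z₂ hz₂).trans (hcst z₁ hz₁).symm)
    linear_combination this
  · rw [eq_div_iff (hden0 z hz)]
    linear_combination hden z hz

/-- A left inverse given by a rational function extends to all points of analyticity at which its
denominator does not vanish. -/
theorem eval_div_eval_eq_of_analyticAt {σ : Type*} {q : ℂ → σ → ℂ} {N D : MvPolynomial σ ℂ}
    {E : Set ℂ} (hE : Eᶜ ∈ codiscrete ℂ) (hinv : ∀ z ∉ E, eval (q z) N / eval (q z) D = z)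
    {w : ℂ} (hw : ∀ i, AnalyticAt ℂ (fun z => q z i) w) (hD : eval (q w) D ≠ 0) :
    eval (q w) N / eval (q w) D = w := by
  have hc : ContinuousAt (fun z => eval (q z) N / eval (q z) D) w :=
    (AnalyticAt.eval_mvPolynomial hw N).continuousAt.div
      (AnalyticAt.eval_mvPolynomial hw D).continuousAt hD
  refine ((hc.eventuallyEq_nhds_iff_eventuallyEq_nhdsNE continuousAt_id).1 ?_).eq_of_nhds
  filter_upwards [mem_nhdsNE_of_mem_codiscrete hE w] with z hz using hinv z hz

/-- If an injective meromorphic curve `p` lies on `q`, then the denominator of a rational inverse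
of `q` vanishes on `p` only in a closed discrete set of parameters. -/
theorem eval_den_ne_zero_mem_codiscrete {σ : Type*} [Finite σ] {p q : ℂ → σ → ℂ}
    (hp : ∀ i, MeromorphicOn (fun z => p z i) Set.univ)
    (hpq : p '' {z | ∀ i, AnalyticAt ℂ (fun w => p w i) z} ⊆
      q '' {z | ∀ i, AnalyticAt ℂ (fun w => q w i) z})
    {S : Set ℂ} (hS : S ∈ codiscrete ℂ) (hinj : Set.InjOn p S)
    {D : MvPolynomial σ ℂ} {E : Set ℂ} (hE : Eᶜ ∈ codiscrete ℂ)
    (hD : ∀ z ∉ E, eval (q z) D ≠ 0) :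
    {z | eval (p z) D ≠ 0} ∈ codiscrete ℂ := by
  have hg : MeromorphicOn (fun z => eval (p z) D) Set.univ := fun z hz =>
    MeromorphicAt.eval_mvPolynomial (fun i => hp i z hz) D
  by_cases hord : ∃ u ∈ Set.univ, meromorphicOrderAt (fun z => eval (p z) D) u ≠ ⊤
  · exact MeromorphicOn.eventually_codiscreteWithin_apply_ne_zero hg
      ((hg.exists_meromorphicOrderAt_ne_top_iff_forall_mem isConnected_univ).1 hord)
  · exfalso
    push Not at hord
    have hzero : {z | eval (p z) D = 0} ∈ codiscrete ℂ :=
      mem_codiscrete.2 fun x => by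
        rw [disjoint_principal_right, compl_compl]
        exact meromorphicOrderAt_eq_top_iff.1 (hord x (Set.mem_univ x))
    have hAn : {z | ∀ i, AnalyticAt ℂ (fun w => p w i) z} ∈ codiscrete ℂ :=
      eventually_all.2 fun i => (hp i).analyticAt_mem_codiscreteWithin
    set T := S ∩ ({z | eval (p z) D = 0} ∩ {z | ∀ i, AnalyticAt ℂ (fun w => p w i) z})
    have hT : T ∈ codiscrete ℂ := inter_mem hS (inter_mem hzero hAn)
    have hEc : E.Countable := by simpa using countable_compl_of_mem_codiscrete hE
    have hmaps : Set.MapsTo p T (q '' E) := by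
      rintro z ⟨-, hz0, hza⟩
      obtain ⟨w, -, hw⟩ := hpq ⟨z, hza, rfl⟩
      refine ⟨w, ?_, hw⟩
      by_contra hwE
      exact hD w hwE (by rw [hw]; exact hz0)
    have hTc : T.Countable :=
      hmaps.countable_of_injOn (hinj.mono Set.inter_subset_left) (hEc.image q)
    have := hTc.union (countable_compl_of_mem_codiscrete hT)
    rw [Set.union_compl_self] at this
    exact not_countable_complex this

/-- A meromorphic curve contained in another one, both with rational inverses, is obtained
from it by a Möbius change of parameter. -/
theorem exists_moebius_of_image_subset {σ : Type*} [Finite σ] {p q : ℂ → σ → ℂ}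
    (hp : ∀ i, MeromorphicOn (fun z => p z i) Set.univ)
    (hpq : p '' {z | ∀ i, AnalyticAt ℂ (fun w => p w i) z} ⊆
      q '' {z | ∀ i, AnalyticAt ℂ (fun w => q w i) z})
    {Pnum Pden : MvPolynomial σ ℂ} {Ep : Set ℂ} (hEp : Epᶜ ∈ codiscrete ℂ)
    (hP : ∀ z ∉ Ep, eval (p z) Pden ≠ 0 ∧ eval (p z) Pnum / eval (p z) Pden = z)
    {Qnum Qden : MvPolynomial σ ℂ} {Eq' : Set ℂ} (hEq : Eq'ᶜ ∈ codiscrete ℂ)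
    (hQ : ∀ z ∉ Eq', eval (q z) Qden ≠ 0 ∧ eval (q z) Qnum / eval (q z) Qden = z) :
    ∃ α β γ δ : ℂ, α * δ - β * γ ≠ 0 ∧
      ∀ᶠ z in codiscrete ℂ, p z = q ((α * z + β) / (γ * z + δ)) := by
  have hAn : {z | ∀ i, AnalyticAt ℂ (fun w => p w i) z} ∈ codiscrete ℂ :=
    eventually_all.2 fun i => (hp i).analyticAt_mem_codiscreteWithin
  have hinjp : Set.InjOn p Epᶜ := fun z hz w hw hzw => by
    rw [← (hP z hz).2, ← (hP w hw).2, hzw]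
  have hPD : {z | eval (p z) Pden ≠ 0} ∈ codiscrete ℂ :=
    mem_of_superset hEp fun z hz => (hP z hz).1
  have hQD := eval_den_ne_zero_mem_codiscrete hp hpq hEp hinjp hEq fun z hz => (hQ z hz).1
  set U : Set ℂ := {z | ∀ i, AnalyticAt ℂ (fun w => p w i) z} ∩
    ({z | eval (p z) Pden ≠ 0} ∩ {z | eval (p z) Qden ≠ 0})
  have hU : U ∈ codiscrete ℂ := inter_mem hAn (inter_mem hPD hQD)
  have hleft : ∀ z ∈ U, eval (p z) Pnum / eval (p z) Pden = z := fun z hz =>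
    eval_div_eval_eq_of_analyticAt hEp (fun w hw => (hP w hw).2) hz.1 hz.2.1
  set φ : ℂ → ℂ := fun z => eval (p z) Qnum / eval (p z) Qden with hφ_def
  have hφ : ∀ z ∈ U, (∀ i, AnalyticAt ℂ (fun w => q w i) (φ z)) ∧ q (φ z) = p z := by
    intro z hz
    obtain ⟨w, hw, hwz⟩ := hpq ⟨z, hz.1, rfl⟩
    have hφw : φ z = w := by
      rw [hφ_def]
      simp only [← hwz]
      exact eval_div_eval_eq_of_analyticAt hEq (fun w hw => (hQ w hw).2) hw
        (by rw [hwz]; exact hz.2.2)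
    rw [hφw]
    exact ⟨hw, hwz⟩
  have hφm : MeromorphicOn φ Set.univ := fun z hz =>
    (MeromorphicAt.eval_mvPolynomial (fun i => hp i z hz) Qnum).fun_div
      (MeromorphicAt.eval_mvPolynomial (fun i => hp i z hz) Qden)
  have hφa : ∀ z ∈ U, AnalyticAt ℂ φ z := fun z hz =>
    (AnalyticAt.eval_mvPolynomial hz.1 Qnum).fun_div
      (AnalyticAt.eval_mvPolynomial hz.1 Qden) hz.2.2
  have hφi : Set.InjOn φ U := fun z hz w hw hzw => by
    rw [← hleft z hz, ← hleft w hw, ← (hφ z hz).2, ← (hφ w hw).2, hzw]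
  obtain ⟨z₀, hz₀⟩ := nonempty_of_mem (mem_nhdsNE_of_mem_codiscrete hU 0)
  have hd : deriv φ z₀ ≠ 0 := by
    set ψ : ℂ → ℂ := fun w => eval (q w) Pnum / eval (q w) Pden
    have hψ : AnalyticAt ℂ ψ (φ z₀) :=
      (AnalyticAt.eval_mvPolynomial (hφ z₀ hz₀).1 Pnum).fun_div
        (AnalyticAt.eval_mvPolynomial (hφ z₀ hz₀).1 Pden)
        (by rw [(hφ z₀ hz₀).2]; exact hz₀.2.1)
    have hcomp := hψ.differentiableAt.hasDerivAt.comp z₀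
      (hφa z₀ hz₀).differentiableAt.hasDerivAt
    have hid : ψ ∘ φ =ᶠ[𝓝 z₀] id := by
      filter_upwards [(mem_codiscrete'.1 hU).1.mem_nhds hz₀] with z hz
      simp only [ψ, Function.comp_apply, (hφ z hz).2, id, hleft z hz]
    intro h0
    have := (hcomp.congr_of_eventuallyEq hid.symm).unique (hasDerivAt_id z₀)
    simp [h0] at this
  obtain ⟨α, β, γ, δ, hdet, hm⟩ := hφm.exists_moebius_of_injOn hU hφa hφi hz₀ hd
  refine ⟨α, β, γ, δ, hdet, ?_⟩
  filter_upwards [hU, (Set.finite_singleton z₀).compl_mem_codiscrete] with z hz hz'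
  rw [← hm z ⟨hz, hz'⟩, (hφ z hz).2]

/-- Theorem `th-ref`: an affine equivalence between two meromorphic
curves admitting rational inverses is accompanied by a Möbius transformation in the
parameter space. -/
theorem affine_equivalence_induces_moebius (n : ℕ)
    (p q : ℂ → (Fin n → ℂ))
    (hpm : ∀ i, MeromorphicOn (fun z => p z i) Set.univ)
    (hqm : ∀ i, MeromorphicOn (fun z => q z i) Set.univ)
    (C₁ C₂ : Set (Fin n → ℂ))
    (hC₁ : C₁ = p '' {z | ∀ i, AnalyticAt ℂ (fun w => p w i) z})
    (hC₂ : C₂ = q '' {z | ∀ i, AnalyticAt ℂ (fun w => q w i) z})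
    (Pnum Pden : MvPolynomial (Fin n) ℂ)
    (Ep : Set ℂ) (hEpc : IsClosed Ep) (hEpa : ∀ w : ℂ, ¬ AccPt w (Filter.principal Ep))
    (hPinv : ∀ z ∉ Ep, eval (p z) Pden ≠ 0 ∧ eval (p z) Pnum / eval (p z) Pden = z)
    (Qnum Qden : MvPolynomial (Fin n) ℂ)
    (Eq' : Set ℂ) (hEqc : IsClosed Eq') (hEqa : ∀ w : ℂ, ¬ AccPt w (Filter.principal Eq'))
    (hQinv : ∀ z ∉ Eq', eval (q z) Qden ≠ 0 ∧ eval (q z) Qnum / eval (q z) Qden = z)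
    (A : Matrix (Fin n) (Fin n) ℂ) (hA : IsUnit A.det) (b : Fin n → ℂ)
    (hf : (fun x => A.mulVec x + b) '' C₁ = C₂) :
    ∃ α β γ δ : ℂ, α * δ - β * γ ≠ 0 ∧
      ∃ E : Set ℂ, IsClosed E ∧ (∀ w : ℂ, ¬ AccPt w (Filter.principal E)) ∧
        ∀ z ∉ E, A.mulVec (p z) + b = q ((α * z + β) / (γ * z + δ)) := by
  have hcod : ∀ {E : Set ℂ}, (∀ w : ℂ, ¬ AccPt w (𝓟 E)) → Eᶜ ∈ codiscrete ℂ := fun h =>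
    mem_codiscrete_accPt.2 (by rwa [compl_compl])
  set p' : ℂ → Fin n → ℂ := fun z => A.mulVec (p z) + b with hp'_def
  have hp'_apply : ∀ i, (fun z => p' z i) = fun z => (∑ j, A i j * p z j) + b i := fun i => rfl
  have hback : ∀ z i, p z i = ∑ j, A⁻¹ i j * (p' z j - b j) := fun z i => by
    have : A⁻¹.mulVec (p' z - b) = p z := by
      simp [hp'_def, Matrix.mulVec_mulVec, Matrix.nonsing_inv_mul A hA]
    exact (congrFun this i).symm
  have hp'm : ∀ i, MeromorphicOn (fun z => p' z i) Set.univ := fun i z hz => by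
    rw [hp'_apply]
    exact (MeromorphicAt.fun_sum fun j _ =>
      (MeromorphicAt.const (A i j) z).fun_mul (hpm j z hz)).fun_add (.const _ z)
  have himage : p' '' {z | ∀ i, AnalyticAt ℂ (fun w => p' w i) z} ⊆
      q '' {z | ∀ i, AnalyticAt ℂ (fun w => q w i) z} := by
    rw [← hC₂, ← hf, hC₁]
    rintro _ ⟨z, hz, rfl⟩
    refine ⟨p z, ⟨z, fun i => ?_, rfl⟩, rfl⟩
    simp only [hback]
    exact Finset.analyticAt_fun_sum _ fun j _ =>
      analyticAt_const.fun_mul ((hz j).fun_sub analyticAt_const)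
  let s : Fin n → MvPolynomial (Fin n) ℂ := fun i => ∑ j, C (A⁻¹ i j) * (X j - C (b j))
  have hs : ∀ z (R : MvPolynomial (Fin n) ℂ), eval (p' z) (bind₁ s R) = eval (p z) R := by
    intro z R
    have h1 : (fun i => eval (p' z) (s i)) = p z := by
      funext i
      simp [s, hback]
    rw [← h1]
    exact eval₂Hom_bind₁ _ _ _ _
  obtain ⟨α, β, γ, δ, hdet, hev⟩ := exists_moebius_of_image_subset hp'm himage
    (hcod hEpa) (Pnum := bind₁ s Pnum) (Pden := bind₁ s Pden)
    (fun z hz => by simpa only [hs] using hPinv z hz) (hcod hEqa) hQinv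
  refine ⟨α, β, γ, δ, hdet, {z | p' z = q ((α * z + β) / (γ * z + δ))}ᶜ,
    (mem_codiscrete'.1 hev).1.isClosed_compl, mem_codiscrete_accPt.1 hev, fun z hz => ?_⟩
  simpa using hz
end

section
/- Let p, q : ℂ ⇢ ℂⁿ have all components meromorphic on ℂ, parametrizing curves C₁, C₂ ⊆ ℂⁿ (their images over the points of analyticity) not contained in any hyperplane of ℂⁿ, so that Δ(p) and Δ(q) are not identically zero. Assume p and q admit rational inverses: there exist rational functions P, Q : ℂⁿ ⇢ ℂ (quotients of polynomials in n variables over ℂ) with P(p(z)) = z and Q(q(z)) = z for all z outside closed sets with no accumulation points. If C₁ and C₂ are affinely equivalent, i.e., there is f(x) = Ax + b with A invertible and f(C₁) = C₂, then there exists a Möbius transformation φ such that I_i(p)(z) = I_i(q ∘ φ)(z) for every i ∈ {0, 1, …, n} and every z outside a closed set with no accumulation point in ℂ. -/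
/-- `D(u)(z)`: the `n×n` matrix whose columns are `u'(z), u''(z), …, u⁽ⁿ⁾(z)`. -/
noncomputable def Dmat (n : ℕ) (u : ℂ → (Fin n → ℂ)) (z : ℂ) : Matrix (Fin n) (Fin n) ℂ :=
  Matrix.of fun (i j : Fin n) => iteratedDeriv (j.1 + 1) u z i

/-- `Δ(u)(z) := det D(u)(z)`. -/
noncomputable def Δmat (n : ℕ) (u : ℂ → (Fin n → ℂ)) (z : ℂ) : ℂ :=
  (Dmat n u z).det

/-- `A_i(u)(z)`: the determinant obtained from `Δ(u)(z)` by replacing the column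
`u⁽ⁱ⁾(z)` with `u⁽ⁿ⁺¹⁾(z)` (the index `i : Fin n` encodes `i+1 ∈ {1,…,n}`). -/
noncomputable def Ainv (n : ℕ) (u : ℂ → (Fin n → ℂ)) (i : Fin n) (z : ℂ) : ℂ :=
  (Matrix.of fun (r j : Fin n) =>
    if j = i then iteratedDeriv (n + 1) u z r else iteratedDeriv (j.1 + 1) u z r).det

/-- `I_i(u)(z) := A_i(u)(z)/Δ(u)(z)` (the index `i : Fin n` encodes `i+1 ∈ {1,…,n}`). -/
noncomputable def Iinv (n : ℕ) (u : ℂ → (Fin n → ℂ)) (i : Fin n) (z : ℂ) : ℂ :=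
  Ainv n u i z / Δmat n u z

/-- `I_0(u)(z) := det[u'(z), …, u⁽ⁿ⁻¹⁾(z), u⁽ⁿ⁺²⁾(z)] / Δ(u)(z)`. -/
noncomputable def I0inv (n : ℕ) (u : ℂ → (Fin n → ℂ)) (z : ℂ) : ℂ :=
  (Matrix.of fun (r j : Fin n) =>
    if j.1 = n - 1 then iteratedDeriv (n + 2) u z r else iteratedDeriv (j.1 + 1) u z r).det /
    Δmat n u z

open MvPolynomial

section
open Filter Topology

theorem countable_setOf_not {P : ℂ → Prop} (h : ∀ z, ∀ᶠ w in 𝓝[≠] z, P w) :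
    {z | ¬ P z}.Countable := by
  apply (HereditarilyLindelofSpace.isLindelof _).countable_of_isDiscrete
  rw [isDiscrete_iff_nhdsNE]
  intro z _
  rw [← disjoint_iff]
  exact Filter.disjoint_principal_right.2 (by simpa [Set.compl_ofPred] using! h z)

theorem MeromorphicAt.eval_mvPolynomial_s6 {σ : Type*} {f : ℂ → σ → ℂ} {z : ℂ}
    (hf : ∀ i, MeromorphicAt (f · i) z) (F : MvPolynomial σ ℂ) :
    MeromorphicAt (fun x ↦ eval (f x) F) z := by
  induction F using MvPolynomial.induction_on with
  | C k => simp
  | add p q hp hq => simpa using hp.fun_add hq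
  | mul_X p i hp => simpa using hp.fun_mul (hf i)

theorem AnalyticAt.eval_mvPolynomial_s6 {σ : Type*} {f : ℂ → σ → ℂ} {z : ℂ}
    (hf : ∀ i, AnalyticAt ℂ (f · i) z) (F : MvPolynomial σ ℂ) :
    AnalyticAt ℂ (fun x ↦ eval (f x) F) z := by
  simpa [MvPolynomial.aeval_eq_eval] using AnalyticAt.aeval_mvPolynomial hf F

theorem eventually_nhdsNE_of_not_accPt {E : Set ℂ}
    (hE : ∀ w : ℂ, ¬ AccPt w (𝓟 E)) (z : ℂ) : ∀ᶠ w in 𝓝[≠] z, w ∉ E := by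
  simpa [accPt_iff_frequently_nhdsNE] using hE z

/-- An entire function of at most linear growth is affine. -/
theorem exists_affine_of_norm_le {H : ℂ → ℂ} (hH : Differentiable ℂ H) {L M : ℝ} {z₀ : ℂ}
    (hb : ∀ z, ‖H z‖ ≤ L + M * ‖z - z₀‖) : ∃ a c : ℂ, ∀ z, H z = a + c * (z - z₀) := by
  have hk : Differentiable ℂ (dslope H z₀) := by
    rw [← differentiableOn_univ] at hH ⊢
    exact (Complex.differentiableOn_dslope univ_mem).2 hH
  have hL : ‖H z₀‖ ≤ L := by simpa using hb z₀
  obtain ⟨B, hB⟩ := (isCompact_closedBall z₀ 1).exists_bound_of_continuousOn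
    hk.continuous.continuousOn
  have hbd : Bornology.IsBounded (Set.range (dslope H z₀)) := by
    refine isBounded_iff_forall_norm_le.2 ⟨max B (2 * L + M), ?_⟩
    rintro _ ⟨z, rfl⟩
    by_cases hz : z ∈ Metric.closedBall z₀ 1
    · exact (hB z hz).trans (le_max_left _ _)
    · refine le_trans ?_ (le_max_right _ _)
      have h1 : 1 < ‖z - z₀‖ := by simpa [dist_eq_norm] using hz
      have hne : z ≠ z₀ := by rintro rfl; simp at h1; linarith
      rw [dslope_of_ne _ hne, slope_def_field, norm_div, div_le_iff₀ (by linarith)]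
      have h2 := norm_sub_le (H z) (H z₀)
      have h3 := hb z
      have h4 := norm_nonneg (H z₀)
      nlinarith
  obtain ⟨c, hc⟩ := hk.exists_const_forall_eq_of_bounded hbd
  refine ⟨H z₀, c, fun z ↦ ?_⟩
  have := sub_smul_dslope H z₀ z
  rw [hc, smul_eq_mul] at this
  linear_combination -this

theorem exists_affine_of_meromorphic {h : ℂ → ℂ} (hh : ∀ z, MeromorphicAt h z) {L M : ℝ} {z₀ : ℂ}
    (hb : ∀ z, ∀ᶠ w in 𝓝[≠] z, ‖h w‖ ≤ L + M * ‖w - z₀‖) :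
    ∃ a c : ℂ, ∀ z, ∀ᶠ w in 𝓝[≠] z, h w = a + c * (w - z₀) := by
  have hm : MeromorphicOn h Set.univ := fun z _ ↦ hh z
  set H := toMeromorphicNFOn h Set.univ
  have heq : ∀ z, h =ᶠ[𝓝[≠] z] H := fun z ↦ (hm.toMeromorphicNFOn_eq_self_on_nhdsNE (Set.mem_univ z)).symm
  have hcont : ∀ z : ℂ, ContinuousAt (fun w ↦ L + M * ‖w - z₀‖) z := fun z ↦ by fun_prop
  have han : ∀ z, AnalyticAt ℂ H z := by
    intro z
    rw [← (meromorphicNFOn_toMeromorphicNFOn h Set.univ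
      (Set.mem_univ z)).meromorphicOrderAt_nonneg_iff_analyticAt,
      meromorphicOrderAt_toMeromorphicNFOn hm (Set.mem_univ z)]
    by_contra hneg
    rw [not_le, ← tendsto_cobounded_iff_meromorphicOrderAt_neg (hh z),
      ← tendsto_norm_atTop_iff_cobounded] at hneg
    exact not_tendsto_atTop_of_tendsto_nhds ((hcont z).tendsto.mono_left nhdsWithin_le_nhds)
      (tendsto_atTop_mono' _ (hb z) hneg)
  obtain ⟨a, c, hac⟩ := exists_affine_of_norm_le (H := H) (L := L) (M := M) (z₀ := z₀)
    (fun z ↦ (han z).differentiableAt) (by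
      intro z
      refine le_of_tendsto_of_tendsto
        ((han z).continuousAt.norm.tendsto.mono_left nhdsWithin_le_nhds)
        ((hcont z).tendsto.mono_left (nhdsWithin_le_nhds (s := {z}ᶜ))) ?_
      filter_upwards [hb z, heq z] with w h1 h2
      rwa [← h2])
  exact ⟨a, c, fun z ↦ (heq z).mono fun w hw ↦ hw.trans (hac w)⟩

theorem exists_notMem_of_countable {S : Set ℂ} (hS : S.Countable) : ∃ z, z ∉ S :=
  (hS.dense_compl ℂ).nonempty

/-- A meromorphic function on `ℂ` with a meromorphic left inverse is a Möbius transformation. -/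
theorem exists_mobius_of_leftInverse {φ ψ : ℂ → ℂ} (hφ : ∀ z, MeromorphicAt φ z)
    (hψ : ∀ z, MeromorphicAt ψ z) (h : ∀ z, ∀ᶠ w in 𝓝[≠] z, ψ (φ w) = w) :
    ∃ α β γ δ : ℂ, α * δ - β * γ ≠ 0 ∧
      ∀ z, ∀ᶠ w in 𝓝[≠] z, γ * w + δ ≠ 0 ∧ φ w = (α * w + β) / (γ * w + δ) := by
  have hS := countable_setOf_not h
  have hfib : ∀ N : Set ℂ, N.Countable → {z | ψ (φ z) = z ∧ φ z ∈ N}.Countable := by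
    intro N hN
    refine (hN.image ψ).mono ?_
    rintro z ⟨h1, h2⟩
    exact ⟨φ z, h2, h1⟩
  obtain ⟨z₀, hz₀⟩ := exists_notMem_of_countable (hS.union (hfib _
    (countable_setOf_not fun z ↦ (hψ z).eventually_analyticAt)))
  simp only [Set.mem_union, Set.mem_ofPred_eq, not_or, not_not, not_and] at hz₀
  obtain ⟨hψφ, hz₀⟩ := hz₀
  have hψan := hz₀ hψφ
  set w₀ := φ z₀ with hw₀
  obtain ⟨L, hL, hbig⟩ := hψan.differentiableAt.isBigO_sub.exists_pos
  obtain ⟨ε, hε, hball⟩ := Metric.eventually_nhds_iff.1 hbig.bound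
  rw [hψφ] at hball
  have hmer : ∀ z, MeromorphicAt (fun z ↦ (z - z₀) / (φ z - w₀)) z := fun z ↦ by
    have := hφ z
    fun_prop
  obtain ⟨a, c, hac⟩ := exists_affine_of_meromorphic (z₀ := z₀) (L := L) (M := ε⁻¹) hmer (by
    intro z
    filter_upwards [h z] with w hw
    rw [norm_div]
    have h0 := norm_nonneg (φ w - w₀)
    by_cases hd : dist (φ w) w₀ < ε
    · have h1 := hball hd
      rw [hw] at h1
      have : 0 ≤ ε⁻¹ * ‖w - z₀‖ := by positivity
      have := div_le_of_le_mul₀ h0 hL.le h1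
      linarith
    · rw [not_lt, dist_eq_norm] at hd
      have : ‖w - z₀‖ / ‖φ w - w₀‖ ≤ ε⁻¹ * ‖w - z₀‖ := by
        rw [div_eq_inv_mul]
        gcongr
      linarith)
  have hne : ∀ w, w ≠ z₀ → ψ (φ w) = w → φ w - w₀ ≠ 0 := by
    intro w h1 h2 h3
    rw [sub_eq_zero.1 h3, hψφ] at h2
    exact h1 h2.symm
  have hkey : ∀ z, ∀ᶠ w in 𝓝[≠] z, ψ (φ w) = w ∧ a + c * (w - z₀) ≠ 0 ∧
      φ w = w₀ + (w - z₀) / (a + c * (w - z₀)) := by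
    intro z
    have hz₀' : ∀ᶠ w in 𝓝[≠] z, w ≠ z₀ := by
      by_cases hz : z = z₀
      · subst hz; exact self_mem_nhdsWithin
      · exact nhdsWithin_le_nhds (isOpen_ne.mem_nhds hz)
    filter_upwards [h z, hac z, hz₀'] with w h1 h2 h3
    have h4 := hne w h3 h1
    have h5 := sub_ne_zero.2 h3
    rw [← h2]
    refine ⟨h1, div_ne_zero h5 h4, ?_⟩
    field_simp
    ring
  have ha : a ≠ 0 := by
    rintro rfl
    have hcount := countable_setOf_not hkey
    obtain ⟨z, hz⟩ := exists_notMem_of_countable (hcount.union (hfib _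
      (Set.countable_singleton (w₀ + 1 / c))))
    obtain ⟨hz, h4⟩ := not_or.1 hz
    obtain ⟨h1, h2, h3⟩ := not_not.1 hz
    refine h4 ⟨h1, ?_⟩
    rw [Set.mem_singleton_iff]
    rw [zero_add] at h2 h3
    have h5 := left_ne_zero_of_mul h2
    have h6 := right_ne_zero_of_mul h2
    rw [h3]
    field_simp
  refine ⟨w₀ * c + 1, w₀ * (a - c * z₀) - z₀, c, a - c * z₀, ?_, fun z ↦ ?_⟩
  · ring_nf
    exact ha
  · filter_upwards [hkey z] with w hw
    have hd : c * w + (a - c * z₀) = a + c * (w - z₀) := by ring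
    rw [hd]
    refine ⟨hw.2.1, ?_⟩
    rw [hw.2.2, eq_div_iff hw.2.1, add_mul, div_mul_cancel₀ _ hw.2.1]
    ring

theorem iteratedDeriv_succ_affine {n : ℕ} {u v : ℂ → Fin n → ℂ} {z : ℂ}
    (hu : AnalyticAt ℂ u z) (A : Matrix (Fin n) (Fin n) ℂ) (b : Fin n → ℂ)
    (h : v =ᶠ[𝓝 z] fun w ↦ A.mulVec (u w) + b) (k : ℕ) :
    iteratedDeriv (k + 1) v z = A.mulVec (iteratedDeriv (k + 1) u z) := by
  have hadd : v =ᶠ[𝓝 z] fun w ↦ b + (A.mulVecLin.toContinuousLinearMap ∘ u) w := by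
    filter_upwards [h] with w hw
    simp [hw, add_comm]
  rw [hadd.iteratedDeriv_eq, iteratedDeriv_const_add k.succ_pos, iteratedDeriv, iteratedDeriv,
    ContinuousLinearMap.iteratedFDeriv_comp_left _ (hu.contDiffAt (n := ⊤)) le_top]
  simp

theorem det_of_mulVec {n : ℕ} (A : Matrix (Fin n) (Fin n) ℂ) (c d : Fin n → Fin n → ℂ)
    (h : ∀ j, d j = A.mulVec (c j)) :
    (Matrix.of fun r j ↦ d j r).det = A.det * (Matrix.of fun r j ↦ c j r).det := by
  rw [← Matrix.det_mul]
  congr 1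
  ext r j
  simp [h, Matrix.mul_apply, Matrix.mulVec, dotProduct]

section
variable {n : ℕ} {u v : ℂ → Fin n → ℂ} {z : ℂ} {A : Matrix (Fin n) (Fin n) ℂ}

theorem Δmat_affine
    (h : ∀ k, iteratedDeriv (k + 1) v z = A.mulVec (iteratedDeriv (k + 1) u z)) :
    Δmat n v z = A.det * Δmat n u z :=
  det_of_mulVec A (fun j ↦ iteratedDeriv (j.1 + 1) u z) (fun j ↦ iteratedDeriv (j.1 + 1) v z)
    fun j ↦ h j

theorem Iinv_affine (hA : A.det ≠ 0)
    (h : ∀ k, iteratedDeriv (k + 1) v z = A.mulVec (iteratedDeriv (k + 1) u z)) (i : Fin n) :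
    Iinv n v i z = Iinv n u i z := by
  have hnum : Ainv n v i z = A.det * Ainv n u i z := by
    have := det_of_mulVec A
      (fun j ↦ if j = i then iteratedDeriv (n + 1) u z else iteratedDeriv (j.1 + 1) u z)
      (fun j ↦ if j = i then iteratedDeriv (n + 1) v z else iteratedDeriv (j.1 + 1) v z)
      (fun j ↦ by split_ifs <;> exact h _)
    simpa only [Ainv, ite_apply] using this
  rw [Iinv, Iinv, Δmat_affine h, hnum, mul_div_mul_left _ _ hA]

theorem I0inv_affine (hA : A.det ≠ 0)
    (h : ∀ k, iteratedDeriv (k + 1) v z = A.mulVec (iteratedDeriv (k + 1) u z)) :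
    I0inv n v z = I0inv n u z := by
  have hnum := det_of_mulVec A
    (fun j ↦ if j.1 = n - 1 then iteratedDeriv (n + 2) u z else iteratedDeriv (j.1 + 1) u z)
    (fun j ↦ if j.1 = n - 1 then iteratedDeriv (n + 2) v z else iteratedDeriv (j.1 + 1) v z)
    (fun j ↦ by split_ifs <;> exact h _)
  simp only [ite_apply] at hnum
  rw [I0inv, I0inv, Δmat_affine h, hnum, mul_div_mul_left _ _ hA]

end

theorem meromorphicAt_affine {n : ℕ} {u : ℂ → Fin n → ℂ} {z : ℂ}
    (hu : ∀ i, MeromorphicAt (fun w ↦ u w i) z) (A : Matrix (Fin n) (Fin n) ℂ) (b : Fin n → ℂ)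
    (i : Fin n) : MeromorphicAt (fun w ↦ (A.mulVec (u w) + b) i) z := by
  simp only [Pi.add_apply, Matrix.mulVec, dotProduct]
  exact (MeromorphicAt.fun_sum fun j _ ↦ (MeromorphicAt.const _ z).fun_mul (hu j)).fun_add
    (MeromorphicAt.const _ z)

theorem analyticAt_affine {n : ℕ} {u : ℂ → Fin n → ℂ} {z : ℂ}
    (hu : ∀ i, AnalyticAt ℂ (fun w ↦ u w i) z) (A : Matrix (Fin n) (Fin n) ℂ) (b : Fin n → ℂ)
    (i : Fin n) : AnalyticAt ℂ (fun w ↦ (A.mulVec (u w) + b) i) z := by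
  simp only [Pi.add_apply, Matrix.mulVec, dotProduct]
  exact (Finset.analyticAt_fun_sum _ fun j _ ↦ analyticAt_const.fun_mul (hu j)).fun_add
    analyticAt_const

theorem rational_inverse_apply {n : ℕ} {q : ℂ → Fin n → ℂ} {num den : MvPolynomial (Fin n) ℂ}
    {w : ℂ} (hq : ∀ i, AnalyticAt ℂ (fun w ↦ q w i) w) (hden : eval (q w) den ≠ 0)
    (h : ∀ᶠ z in 𝓝[≠] w, eval (q z) num / eval (q z) den = z) :
    eval (q w) num / eval (q w) den = w := by
  have hc : ContinuousAt (fun z ↦ eval (q z) num / eval (q z) den) w :=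
    (AnalyticAt.eval_mvPolynomial_s6 hq num).continuousAt.div
      (AnalyticAt.eval_mvPolynomial_s6 hq den).continuousAt hden
  exact tendsto_nhds_unique ((hc.tendsto.mono_left nhdsWithin_le_nhds).congr' h)
    (tendsto_id.mono_left nhdsWithin_le_nhds)

/-- If the image of `r` lies in the curve parametrized by `q`, whose rational inverse has
denominator `den`, then `den` vanishes along `r` only at isolated points. -/
theorem eventually_eval_den_ne_zero {n : ℕ} {q r : ℂ → Fin n → ℂ}
    {den : MvPolynomial (Fin n) ℂ} {ψ : (Fin n → ℂ) → ℂ} {S T : Set ℂ}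
    (hr : ∀ z i, MeromorphicAt (fun w ↦ r w i) z)
    (hT : ∀ z, ∀ᶠ w in 𝓝[≠] z, w ∉ T) (hψ : ∀ z ∉ T, ψ (r z) = z)
    (hS : ∀ z, ∀ᶠ w in 𝓝[≠] z, w ∉ S) (hden : ∀ z ∉ S, eval (q z) den ≠ 0)
    (hrange : ∀ z ∉ T, ∃ w, q w = r z) (z : ℂ) :
    ∀ᶠ w in 𝓝[≠] z, eval (r w) den ≠ 0 := by
  refine (MeromorphicAt.eval_mvPolynomial_s6
    (hr z) den).eventually_eq_zero_or_eventually_ne_zero.resolve_left fun h0 ↦ ?_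
  have hcount : {w | w ∉ T ∧ eval (r w) den = 0}.Countable := by
    refine ((countable_setOf_not hS).image fun w ↦ ψ (q w)).mono ?_
    rintro w ⟨hw, hw0⟩
    obtain ⟨w', hw'⟩ := hrange w hw
    refine ⟨w', fun hmem ↦ hden w' hmem (by rw [hw', hw0]), ?_⟩
    simp only [hw', hψ w hw]
  have hmem : insert z {w | w ∉ T ∧ eval (r w) den = 0} ∈ 𝓝 z :=
    insert_mem_nhds_iff.2 ((hT z).and h0)
  obtain ⟨w, hw, hw'⟩ := ((hcount.insert z).dense_compl ℂ).inter_nhds_nonempty hmem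
  exact hw hw'

end

open Filter Topology in
/-- Theorem `teo29*` / Corollary `teo29**`: if two curves with
meromorphic parametrizations admitting rational inverses, not contained in hyperplanes,
are affinely equivalent, then there is a Möbius transformation `φ` with
`I_i(p) = I_i(q ∘ φ)` for `i = 0, 1, …, n` off a closed set without accumulation
points. -/
theorem affine_equivalent_implies_I_match (n : ℕ) (hn : 1 ≤ n)
    (p q : ℂ → (Fin n → ℂ))
    (hpm : ∀ i, MeromorphicOn (fun z => p z i) Set.univ)
    (hqm : ∀ i, MeromorphicOn (fun z => q z i) Set.univ)
    (C₁ C₂ : Set (Fin n → ℂ))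
    (hC₁ : C₁ = p '' {z | ∀ i, AnalyticAt ℂ (fun w => p w i) z})
    (hC₂ : C₂ = q '' {z | ∀ i, AnalyticAt ℂ (fun w => q w i) z})
    -- C₁ and C₂ are not contained in any hyperplane of ℂⁿ …
    (hhyp₁ : ∀ (a : Fin n → ℂ) (c : ℂ), a ≠ 0 → ∃ x ∈ C₁, ∑ i, a i * x i ≠ c)
    (hhyp₂ : ∀ (a : Fin n → ℂ) (c : ℂ), a ≠ 0 → ∃ x ∈ C₂, ∑ i, a i * x i ≠ c)
    -- … so that Δ(p) and Δ(q) are not identically zero: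
    (hΔp : ∃ z, AnalyticAt ℂ p z ∧ Δmat n p z ≠ 0)
    (hΔq : ∃ z, AnalyticAt ℂ q z ∧ Δmat n q z ≠ 0)
    (Pnum Pden : MvPolynomial (Fin n) ℂ)
    (Ep : Set ℂ) (hEpc : IsClosed Ep) (hEpa : ∀ w : ℂ, ¬ AccPt w (Filter.principal Ep))
    (hPinv : ∀ z ∉ Ep, eval (p z) Pden ≠ 0 ∧ eval (p z) Pnum / eval (p z) Pden = z)
    (Qnum Qden : MvPolynomial (Fin n) ℂ)
    (Eq' : Set ℂ) (hEqc : IsClosed Eq') (hEqa : ∀ w : ℂ, ¬ AccPt w (Filter.principal Eq'))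
    (hQinv : ∀ z ∉ Eq', eval (q z) Qden ≠ 0 ∧ eval (q z) Qnum / eval (q z) Qden = z)
    (A : Matrix (Fin n) (Fin n) ℂ) (hA : IsUnit A.det) (b : Fin n → ℂ)
    (hf : (fun x => A.mulVec x + b) '' C₁ = C₂) :
    ∃ α β γ δ : ℂ, α * δ - β * γ ≠ 0 ∧
      ∃ E : Set ℂ, IsClosed E ∧ (∀ w : ℂ, ¬ AccPt w (Filter.principal E)) ∧
        ∀ z ∉ E,
          I0inv n p z = I0inv n (fun w => q ((α * w + β) / (γ * w + δ))) z ∧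
          ∀ i : Fin n, Iinv n p i z = Iinv n (fun w => q ((α * w + β) / (γ * w + δ))) i z := by
  have hdetA : A.det ≠ 0 := hA.ne_zero
  set r : ℂ → Fin n → ℂ := fun z ↦ A.mulVec (p z) + b with hr
  set g : (Fin n → ℂ) → (Fin n → ℂ) := fun x ↦ A⁻¹.mulVec x + -A⁻¹.mulVec b with hg
  have hgr : ∀ z, g (r z) = p z := fun z ↦ by
    simp [hg, hr, Matrix.mulVec_add, Matrix.mulVec_mulVec, Matrix.nonsing_inv_mul A hA]
  set ψ : (Fin n → ℂ) → ℂ := fun x ↦ eval (g x) Pnum / eval (g x) Pden with hψ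
  have hp : ∀ z i, MeromorphicAt (fun w ↦ p w i) z := fun z i ↦ hpm i z (Set.mem_univ z)
  have hq : ∀ z i, MeromorphicAt (fun w ↦ q w i) z := fun z i ↦ hqm i z (Set.mem_univ z)
  have hrm : ∀ z i, MeromorphicAt (fun w ↦ r w i) z := fun z ↦ meromorphicAt_affine (hp z) A b
  have hpan : ∀ z, ∀ᶠ w in 𝓝[≠] z, ∀ i, AnalyticAt ℂ (fun w ↦ p w i) w := fun z ↦
    eventually_all.2 fun i ↦ (hp z i).eventually_analyticAt
  have hEp := eventually_nhdsNE_of_not_accPt hEpa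
  have hEq := eventually_nhdsNE_of_not_accPt hEqa
  have hrC : ∀ z, (∀ i, AnalyticAt ℂ (fun w ↦ p w i) z) →
      ∃ w, (∀ i, AnalyticAt ℂ (fun w ↦ q w i) w) ∧ q w = r z := by
    intro z hz
    have : r z ∈ C₂ := hf ▸ ⟨p z, hC₁ ▸ ⟨z, hz, rfl⟩, rfl⟩
    rwa [hC₂] at this
  have hψr : ∀ z ∉ Ep, ψ (r z) = z := fun z hz ↦ by
    simp only [hψ, hgr]
    exact (hPinv z hz).2
  have hden : ∀ z, ∀ᶠ w in 𝓝[≠] z, eval (r w) Qden ≠ 0 :=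
    eventually_eval_den_ne_zero (q := q) (ψ := ψ)
      (T := {z | z ∈ Ep ∨ ¬ ∀ i, AnalyticAt ℂ (fun w ↦ p w i) z}) hrm
      (fun z ↦ by
        filter_upwards [hEp z, hpan z] with w h1 h2
        exact fun h ↦ h.elim h1 fun h ↦ h h2)
      (fun z hz ↦ hψr z fun h ↦ hz (.inl h)) hEq (fun z hz ↦ (hQinv z hz).1)
      (fun z hz ↦ by
        obtain ⟨w, -, hw⟩ := hrC z (not_not.1 fun h ↦ hz (.inr h))
        exact ⟨w, hw⟩)
  set φ : ℂ → ℂ := fun z ↦ eval (r z) Qnum / eval (r z) Qden with hφ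
  have hlift : ∀ z, (∀ i, AnalyticAt ℂ (fun w ↦ p w i) z) → eval (r z) Qden ≠ 0 →
      q (φ z) = r z := by
    intro z hz hz0
    obtain ⟨w, hw, hqw⟩ := hrC z hz
    have : φ z = w := by
      simp only [hφ, ← hqw]
      exact rational_inverse_apply hw (hqw ▸ hz0)
        ((hEq w).mono fun x hx ↦ (hQinv x hx).2)
    rw [this, hqw]
  obtain ⟨α, β, γ, δ, hdet, hM⟩ := exists_mobius_of_leftInverse (φ := φ) (ψ := fun w ↦ ψ (q w))
    (fun z ↦ (MeromorphicAt.eval_mvPolynomial_s6 (hrm z) Qnum).fun_div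
      (MeromorphicAt.eval_mvPolynomial_s6 (hrm z) Qden))
    (fun z ↦ (MeromorphicAt.eval_mvPolynomial_s6 (meromorphicAt_affine (hq z) _ _) Pnum).fun_div
      (MeromorphicAt.eval_mvPolynomial_s6 (meromorphicAt_affine (hq z) _ _) Pden))
    (fun z ↦ by
      filter_upwards [hEp z, hpan z, hden z] with w h1 h2 h3
      rw [hlift w h2 h3, hψr w h1])
  refine ⟨α, β, γ, δ, hdet, ?_⟩
  set G : Set ℂ := {z | (∀ i, AnalyticAt ℂ (fun w ↦ p w i) z) ∧ eval (r z) Qden ≠ 0 ∧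
    γ * z + δ ≠ 0} with hG
  have hran : ∀ z ∈ G, ∀ i, AnalyticAt ℂ (fun w ↦ r w i) z := fun z hz ↦
    analyticAt_affine hz.1 A b
  have hGnhds : ∀ z ∈ G, ∀ᶠ w in 𝓝 z, w ∈ G := by
    intro z hz
    have hlin : ContinuousAt (fun w ↦ γ * w + δ) z := by fun_prop
    filter_upwards [eventually_all.2 fun i ↦ (hz.1 i).eventually_analyticAt,
      (AnalyticAt.eval_mvPolynomial_s6 (hran z hz) Qden).continuousAt.eventually_ne hz.2.1,
      hlin.eventually_ne hz.2.2] with w h1 h2 h3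
    exact ⟨h1, h2, h3⟩
  have hφM : ∀ z ∈ G, φ z = (α * z + β) / (γ * z + δ) := by
    intro z hz
    have hc : ContinuousAt φ z :=
      (AnalyticAt.eval_mvPolynomial_s6 (hran z hz) Qnum).continuousAt.div
        (AnalyticAt.eval_mvPolynomial_s6 (hran z hz) Qden).continuousAt hz.2.1
    have hc' : ContinuousAt (fun w ↦ (α * w + β) / (γ * w + δ)) z :=
      ContinuousAt.div (by fun_prop) (by fun_prop) hz.2.2
    exact ((hc.eventuallyEq_nhds_iff_eventuallyEq_nhdsNE hc').1
      ((hM z).mono fun w hw ↦ hw.2)).eq_of_nhds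
  refine ⟨Gᶜ, (isOpen_iff_eventually.2 hGnhds).isClosed_compl, fun z ↦ ?_, fun z hz ↦ ?_⟩
  · rw [accPt_iff_frequently_nhdsNE, not_frequently]
    filter_upwards [hpan z, hden z, hM z] with w h1 h2 h3
    exact not_not.2 ⟨h1, h2, h3.1⟩
  · rw [Set.notMem_compl_iff] at hz
    have hder := iteratedDeriv_succ_affine (analyticAt_pi_iff.2 hz.1) A b
      (v := fun w ↦ q ((α * w + β) / (γ * w + δ))) (by
        filter_upwards [hGnhds z hz] with w hw
        rw [← hφM w hw, hlift w hw.1 hw.2.1])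
    exact ⟨(I0inv_affine hdetA hder).symm, fun i ↦ (Iinv_affine hdetA hder i).symm⟩
end

section
/- Fix an integer n ≥ 1, let q : V → ℂⁿ be analytic on an open set V ⊆ ℂ, and let ω : U → V be analytic on an open set U ⊆ ℂ. Then for every z ∈ U, Δ(q ∘ ω)(z) = (ω'(z))^{n(n+1)/2} · Δ(q)(ω(z)). -/
section ChainRule

variable {𝕜 E : Type*} [NontriviallyNormedField 𝕜]
  [NormedAddCommGroup E] [NormedSpace 𝕜 E]

/-- The coefficient of `q⁽ᵏ⁺¹⁾ ∘ ω` in the expansion of the derivative of `q ∘ ω`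
of order `m + 1`. -/
noncomputable def compDerivCoeff (ω : 𝕜 → 𝕜) : ℕ → ℕ → 𝕜 → 𝕜
  | 0, 0 => deriv ω
  | 0, _ + 1 => 0
  | m + 1, 0 => deriv (compDerivCoeff ω m 0)
  | m + 1, k + 1 => deriv (compDerivCoeff ω m (k + 1)) + deriv ω * compDerivCoeff ω m k

theorem compDerivCoeff_eq_zero_of_lt (ω : 𝕜 → 𝕜) {m k : ℕ} (h : m < k) :
    compDerivCoeff ω m k = 0 := by
  induction m generalizing k with
  | zero => obtain ⟨k, rfl⟩ := Nat.exists_eq_succ_of_ne_zero h.ne'; rfl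
  | succ m ih =>
    obtain ⟨k, rfl⟩ := Nat.exists_eq_succ_of_ne_zero (Nat.ne_zero_of_lt h)
    simp [compDerivCoeff, ih (show m < k + 1 by omega), ih (show m < k by omega)]

theorem compDerivCoeff_self (ω : 𝕜 → 𝕜) (m : ℕ) :
    compDerivCoeff ω m m = deriv ω ^ (m + 1) := by
  induction m with
  | zero => simp [compDerivCoeff]
  | succ m ih =>
    simp [compDerivCoeff, ih, compDerivCoeff_eq_zero_of_lt ω m.lt_succ_self, pow_succ']

theorem AnalyticAt.compDerivCoeff [CompleteSpace 𝕜] {ω : 𝕜 → 𝕜} {z : 𝕜}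
    (hω : AnalyticAt 𝕜 ω z) (m k : ℕ) :
    AnalyticAt 𝕜 (compDerivCoeff ω m k) z := by
  induction m generalizing k with
  | zero =>
    cases k with
    | zero => exact hω.deriv
    | succ k => exact analyticAt_const
  | succ m ih =>
    cases k with
    | zero => exact (ih 0).deriv
    | succ k => exact (ih (k + 1)).deriv.add (hω.deriv.mul (ih k))

/-- Triangular form of the higher chain rule. -/
theorem iteratedDeriv_succ_comp_eq_sum [CompleteSpace 𝕜] [CompleteSpace E]
    {q : 𝕜 → E} {ω : 𝕜 → 𝕜} {z : 𝕜}
    (hq : AnalyticAt 𝕜 q (ω z)) (hω : AnalyticAt 𝕜 ω z) (m : ℕ) :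
    iteratedDeriv (m + 1) (q ∘ ω) z =
      ∑ k ∈ Finset.range (m + 1),
        compDerivCoeff ω m k z • iteratedDeriv (k + 1) q (ω z) := by
  induction m generalizing z with
  | zero =>
    simp [compDerivCoeff, deriv.scomp z hq.differentiableAt hω.differentiableAt]
  | succ m ih =>
    have hev : iteratedDeriv (m + 1) (q ∘ ω) =ᶠ[nhds z] fun x =>
        ∑ k ∈ Finset.range (m + 1),
          compDerivCoeff ω m k x • iteratedDeriv (k + 1) q (ω x) := by
      filter_upwards [hω.eventually_analyticAt,
        hω.continuousAt.eventually hq.eventually_analyticAt] with x hx hqx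
      exact ih hqx hx
    have hterm (k : ℕ) : HasDerivAt
        (fun x => compDerivCoeff ω m k x • iteratedDeriv (k + 1) q (ω x))
        (compDerivCoeff ω m k z • deriv ω z • iteratedDeriv (k + 2) q (ω z) +
          deriv (compDerivCoeff ω m k) z • iteratedDeriv (k + 1) q (ω z)) z := by
      have hd := (hq.iterated_deriv (k + 1)).differentiableAt.hasDerivAt
      rw [← iteratedDeriv_eq_iterate, ← iteratedDeriv_succ] at hd
      exact (hω.compDerivCoeff m k).differentiableAt.hasDerivAt.smul
        (hd.scomp z hω.differentiableAt.hasDerivAt)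
    rw [iteratedDeriv_succ, hev.deriv_eq,
      (HasDerivAt.fun_sum fun k _ => hterm k).deriv, Finset.sum_add_distrib,
      Finset.sum_range_succ' _ (m + 1)]
    have hlast : ∑ k ∈ Finset.range (m + 1),
          deriv (compDerivCoeff ω m k) z • iteratedDeriv (k + 1) q (ω z) =
        ∑ k ∈ Finset.range (m + 1),
          deriv (compDerivCoeff ω m (k + 1)) z • iteratedDeriv (k + 2) q (ω z) +
        deriv (compDerivCoeff ω m 0) z • iteratedDeriv 1 q (ω z) := by
      rw [← Finset.sum_range_succ'
          (fun k => deriv (compDerivCoeff ω m k) z • iteratedDeriv (k + 1) q (ω z)),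
        Finset.sum_range_succ _ (m + 1),
        compDerivCoeff_eq_zero_of_lt ω m.lt_succ_self]
      simp
    rw [hlast, ← add_assoc, ← Finset.sum_add_distrib]
    congr 1
    refine Finset.sum_congr rfl fun k _ => ?_
    simp only [compDerivCoeff, Pi.add_apply, Pi.mul_apply, add_smul, smul_smul]
    rw [add_comm, mul_comm]

end ChainRule

theorem Dmat_comp (n : ℕ) {q : ℂ → Fin n → ℂ} {ω : ℂ → ℂ} {z : ℂ}
    (hq : AnalyticAt ℂ q (ω z)) (hω : AnalyticAt ℂ ω z) :
    Dmat n (q ∘ ω) z =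
      Dmat n q (ω z) * Matrix.of fun k j : Fin n => compDerivCoeff ω j k z := by
  ext i j
  have hsub : Finset.range (j.1 + 1) ⊆ Finset.range n :=
    Finset.range_subset_range.2 j.2
  simp only [Dmat, Matrix.of_apply, Matrix.mul_apply]
  rw [iteratedDeriv_succ_comp_eq_sum hq hω, Finset.sum_subset hsub, Finset.sum_apply,
    ← Fin.sum_univ_eq_sum_range
      (fun k => (compDerivCoeff ω j k z • iteratedDeriv (k + 1) q (ω z)) i)]
  · simp [mul_comm]
  · intro k _ hk
    rw [compDerivCoeff_eq_zero_of_lt ω (by simpa using hk)]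
    simp

/-- Lemma `deltaq`: `Δ(q ∘ ω)(z) = (ω'(z))^(n(n+1)/2) · Δ(q)(ω(z))`. -/
theorem Δmat_comp (n : ℕ) (hn : 1 ≤ n) (V : Set ℂ) (hV : IsOpen V)
    (q : ℂ → (Fin n → ℂ)) (hq : ∀ w ∈ V, AnalyticAt ℂ q w)
    (U : Set ℂ) (hU : IsOpen U) (ω : ℂ → ℂ) (hω : ∀ z ∈ U, AnalyticAt ℂ ω z)
    (hmaps : Set.MapsTo ω U V) (z : ℂ) (hz : z ∈ U) :
    Δmat n (q ∘ ω) z = (deriv ω z) ^ (n * (n + 1) / 2) * Δmat n q (ω z) := by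
  have hωz := hω z hz
  have htri : (Matrix.of fun k j : Fin n => compDerivCoeff ω j k z).IsUpperTriangular :=
    fun k j hjk => congrFun (compDerivCoeff_eq_zero_of_lt ω hjk) z
  have hsum : ∑ i : Fin n, (i.1 + 1) = n * (n + 1) / 2 := by
    have h := Finset.sum_range_succ' (fun i => i) n
    rw [Fin.sum_univ_eq_sum_range (fun i => i + 1), mul_comm n]
    simpa [Finset.sum_range_id] using h.symm
  rw [Δmat, Dmat_comp n (hq _ (hmaps hz)) hωz, Matrix.det_mul,
    Matrix.det_of_isUpperTriangular htri, mul_comm, Δmat, ← hsum,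
    ← Finset.prod_pow_eq_pow_sum]
  simp [compDerivCoeff_self]
end

section
/- Fix an integer n ≥ 1, let q : V → ℂⁿ be analytic on an open set V ⊆ ℂ, and let ω : U → V be analytic on an open set U ⊆ ℂ. Then for every z ∈ U with ω'(z) ≠ 0 and Δ(q)(ω(z)) ≠ 0, one has Δ(q ∘ ω)(z) ≠ 0 and I_n(q ∘ ω)(z) = (n(n+1)/2)·ω''(z)/ω'(z) + ω'(z)·I_n(q)(ω(z)). -/
open scoped Matrix

/-- The coefficient of `u⁽ʲ⁾ ∘ ω` in the `k`-th derivative of `u ∘ ω`. -/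
noncomputable def compCoeff (ω : ℂ → ℂ) : ℕ → ℕ → ℂ → ℂ
  | 0, 0 => fun _ => 1
  | 0, _ + 1 => fun _ => 0
  | k + 1, 0 => deriv (compCoeff ω k 0)
  | k + 1, j + 1 => fun z => deriv (compCoeff ω k (j + 1)) z + deriv ω z * compCoeff ω k j z

theorem compCoeff_of_lt (ω : ℂ → ℂ) {k j : ℕ} (h : k < j) : compCoeff ω k j = fun _ => 0 := by
  induction k generalizing j with
  | zero =>
    obtain ⟨j, rfl⟩ := Nat.exists_eq_add_of_lt h
    rfl
  | succ k ih =>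
    obtain ⟨j, rfl⟩ : ∃ i, j = i + 1 := ⟨j - 1, by omega⟩
    funext z
    simp [compCoeff, ih (show k < j + 1 by omega), ih (show k < j by omega)]

theorem compCoeff_succ_zero (ω : ℂ → ℂ) (k : ℕ) : compCoeff ω (k + 1) 0 = fun _ => 0 := by
  induction k with
  | zero => funext z; simp [compCoeff]
  | succ k ih => funext z; rw [compCoeff, ih]; simp

theorem compCoeff_self (ω : ℂ → ℂ) (k : ℕ) : compCoeff ω k k = fun z => deriv ω z ^ k := by
  induction k with
  | zero => funext z; simp [compCoeff]
  | succ k ih =>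
    funext z
    simp [compCoeff, ih, compCoeff_of_lt ω (Nat.lt_succ_self k), pow_succ']

theorem analyticAt_compCoeff {ω : ℂ → ℂ} {z : ℂ} (hω : AnalyticAt ℂ ω z) (k j : ℕ) :
    AnalyticAt ℂ (compCoeff ω k j) z := by
  induction k generalizing j with
  | zero => cases j <;> exact analyticAt_const
  | succ k ih =>
    cases j with
    | zero => exact (ih 0).deriv
    | succ j => exact (ih (j + 1)).deriv.add (hω.deriv.mul (ih j))

theorem deriv_mul_compCoeff_succ_self {ω : ℂ → ℂ} {z : ℂ} (hω : AnalyticAt ℂ ω z) (k : ℕ) :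
    deriv ω z * compCoeff ω (k + 1) k z =
      (k * (k + 1) : ℂ) / 2 * deriv ω z ^ k * iteratedDeriv 2 ω z := by
  induction k with
  | zero => simp [compCoeff_succ_zero]
  | succ k ih =>
    have h : deriv (compCoeff ω (k + 1) (k + 1)) z =
        (k + 1) * deriv ω z ^ k * iteratedDeriv 2 ω z := by
      rw [compCoeff_self, deriv_fun_pow hω.deriv.differentiableAt, iteratedDeriv_succ,
        iteratedDeriv_one]
      simp
    rw [compCoeff]
    beta_reduce
    rw [h, mul_add, ih]
    push_cast
    ring

theorem iteratedDeriv_comp_eq_sum_compCoeff {E : Type*} [NormedAddCommGroup E] [NormedSpace ℂ E]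
    [CompleteSpace E] {u : ℂ → E} {ω : ℂ → ℂ} {z : ℂ} (hω : AnalyticAt ℂ ω z)
    (hu : AnalyticAt ℂ u (ω z)) (k : ℕ) :
    iteratedDeriv k (u ∘ ω) z =
      ∑ j ∈ Finset.range (k + 1), compCoeff ω k j z • iteratedDeriv j u (ω z) := by
  induction k generalizing z with
  | zero => simp [compCoeff]
  | succ k ih =>
    have hev : iteratedDeriv k (u ∘ ω) =ᶠ[nhds z] fun y =>
        ∑ j ∈ Finset.range (k + 1), compCoeff ω k j y • iteratedDeriv j u (ω y) := by
      filter_upwards [hω.eventually_analyticAt,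
        hω.continuousAt.eventually hu.eventually_analyticAt] with y hy hy'
      exact ih hy hy'
    have hd : HasDerivAt (fun y =>
        ∑ j ∈ Finset.range (k + 1), compCoeff ω k j y • iteratedDeriv j u (ω y))
        (∑ j ∈ Finset.range (k + 1),
          (compCoeff ω k j z • (deriv ω z • iteratedDeriv (j + 1) u (ω z)) +
            deriv (compCoeff ω k j) z • iteratedDeriv j u (ω z))) z := by
      refine HasDerivAt.fun_sum fun j _ => ?_
      refine (analyticAt_compCoeff hω k j).differentiableAt.hasDerivAt.fun_smul ?_
      rw [iteratedDeriv_succ]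
      exact (iteratedDeriv_eq_iterate (n := j) (f := u) ▸ hu.iterated_deriv j).differentiableAt.hasDerivAt.scomp z
        hω.differentiableAt.hasDerivAt
    rw [iteratedDeriv_succ, hev.deriv_eq, hd.deriv, Finset.sum_range_succ' _ (k + 1),
      Finset.sum_add_distrib]
    have h0 : ∑ j ∈ Finset.range (k + 1), deriv (compCoeff ω k j) z • iteratedDeriv j u (ω z) =
        ∑ j ∈ Finset.range (k + 1 + 1),
          deriv (compCoeff ω k j) z • iteratedDeriv j u (ω z) := by
      rw [Finset.sum_range_succ _ (k + 1), compCoeff_of_lt ω (Nat.lt_succ_self k)]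
      simp
    rw [h0, Finset.sum_range_succ' _ (k + 1)]
    simp only [compCoeff, add_smul, Finset.sum_add_distrib, smul_smul, mul_comm (deriv ω z)]
    abel

theorem iteratedDeriv_succ_comp_eq_sum_compCoeff {E : Type*} [NormedAddCommGroup E]
    [NormedSpace ℂ E] [CompleteSpace E] {u : ℂ → E} {ω : ℂ → ℂ} {z : ℂ}
    (hω : AnalyticAt ℂ ω z) (hu : AnalyticAt ℂ u (ω z)) {k n : ℕ} (h : k < n) :
    iteratedDeriv (k + 1) (u ∘ ω) z =
      ∑ j : Fin n, compCoeff ω (k + 1) (j + 1) z • iteratedDeriv (j + 1) u (ω z) := by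
  rw [iteratedDeriv_comp_eq_sum_compCoeff hω hu, Finset.sum_range_succ' _ (k + 1),
    compCoeff_succ_zero, zero_smul, add_zero,
    ← Finset.sum_range fun j =>
      compCoeff ω (k + 1) (j + 1) z • iteratedDeriv (j + 1) u (ω z)]
  refine Finset.sum_subset (Finset.range_subset_range.2 h) fun j _ hj => ?_
  rw [compCoeff_of_lt ω (by simpa using hj), zero_smul]

/-- The matrix expressing the derivatives of `u ∘ ω` of orders `1, …, n` in terms of those
of `u`. -/
noncomputable def compMat (n : ℕ) (ω : ℂ → ℂ) (z : ℂ) : Matrix (Fin n) (Fin n) ℂ :=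
  Matrix.of fun j k => compCoeff ω (k + 1) (j + 1) z

theorem Dmat_comp_s10 {n : ℕ} {u : ℂ → (Fin n → ℂ)} {ω : ℂ → ℂ} {z : ℂ}
    (hω : AnalyticAt ℂ ω z) (hu : AnalyticAt ℂ u (ω z)) :
    Dmat n (u ∘ ω) z = Dmat n u (ω z) * compMat n ω z := by
  ext i k
  simp [Dmat, compMat, Matrix.mul_apply, iteratedDeriv_succ_comp_eq_sum_compCoeff hω hu k.2,
    mul_comm]

theorem compMat_isUpperTriangular (n : ℕ) (ω : ℂ → ℂ) (z : ℂ) :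
    (compMat n ω z).BlockTriangular id := fun j k (h : k < j) => by
  simp [compMat, compCoeff_of_lt ω (Nat.succ_lt_succ h)]

theorem det_compMat_ne_zero (n : ℕ) {ω : ℂ → ℂ} {z : ℂ} (h : deriv ω z ≠ 0) :
    (compMat n ω z).det ≠ 0 := by
  rw [Matrix.det_of_isUpperTriangular (compMat_isUpperTriangular n ω z)]
  exact Finset.prod_ne_zero_iff.2 fun j _ => by simp [compMat, compCoeff_self, h]

theorem Iinv_eq_of_mulVec_eq {n : ℕ} {u : ℂ → (Fin n → ℂ)} {z : ℂ} (hΔ : Δmat n u z ≠ 0)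
    {x : Fin n → ℂ} (hx : Dmat n u z *ᵥ x = iteratedDeriv (n + 1) u z) (i : Fin n) :
    Iinv n u i z = x i := by
  have h : Ainv n u i z = (Dmat n u z).cramer (iteratedDeriv (n + 1) u z) i := by
    rw [Matrix.cramer_apply, Ainv]
    congr 1
    ext r j
    simp [Matrix.updateCol_apply, Dmat]
  rw [Iinv, h, ← hx, Matrix.cramer_eq_adjugate_mulVec, Matrix.mulVec_mulVec,
    Matrix.adjugate_mul, Matrix.smul_mulVec, Matrix.one_mulVec, Pi.smul_apply, smul_eq_mul,
    ← Δmat, mul_div_cancel_left₀ _ hΔ]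

/-- Lemma `Inqomega`:
`I_n(q∘ω) = (n(n+1)/2)·ω''/ω' + ω'·I_n(q)∘ω` wherever `ω' ≠ 0` and `Δ(q)(ω) ≠ 0`. -/
theorem In_comp (n : ℕ) (hn : 1 ≤ n) (V : Set ℂ) (hV : IsOpen V)
    (q : ℂ → (Fin n → ℂ)) (hq : ∀ w ∈ V, AnalyticAt ℂ q w)
    (U : Set ℂ) (hU : IsOpen U) (ω : ℂ → ℂ) (hω : ∀ z ∈ U, AnalyticAt ℂ ω z)
    (hmaps : Set.MapsTo ω U V) (z : ℂ) (hz : z ∈ U)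
    (hω' : deriv ω z ≠ 0) (hΔ : Δmat n q (ω z) ≠ 0) :
    Δmat n (q ∘ ω) z ≠ 0 ∧
      Iinv n (q ∘ ω) ⟨n - 1, by omega⟩ z =
        (n * (n + 1) : ℂ) / 2 * (iteratedDeriv 2 ω z / deriv ω z) +
          deriv ω z * Iinv n q ⟨n - 1, by omega⟩ (ω z) := by
  have hωz := hω z hz
  have hqz := hq _ (hmaps hz)
  have hD := Dmat_comp_s10 hωz hqz
  have hΔ' : Δmat n (q ∘ ω) z ≠ 0 := by
    rw [Δmat, hD, Matrix.det_mul]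
    exact mul_ne_zero hΔ (det_compMat_ne_zero n hω')
  refine ⟨hΔ', ?_⟩
  have hsurj : ∀ A : Matrix (Fin n) (Fin n) ℂ, A.det ≠ 0 → ∀ v, ∃ x, A *ᵥ x = v :=
    fun A hA v => ⟨A⁻¹ *ᵥ v, by
      rw [Matrix.mulVec_mulVec, Matrix.mul_nonsing_inv _ hA.isUnit, Matrix.one_mulVec]⟩
  obtain ⟨x, hx⟩ := hsurj _ hΔ (iteratedDeriv (n + 1) q (ω z))
  obtain ⟨y, hy⟩ := hsurj _ hΔ' (iteratedDeriv (n + 1) (q ∘ ω) z)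
  rw [Iinv_eq_of_mulVec_eq hΔ hx, Iinv_eq_of_mulVec_eq hΔ' hy]
  let b : Fin n → ℂ := fun j => compCoeff ω (n + 1) (j + 1) z
  have hb : iteratedDeriv (n + 1) (q ∘ ω) z =
      Dmat n q (ω z) *ᵥ (b + deriv ω z ^ (n + 1) • x) := by
    rw [iteratedDeriv_succ_comp_eq_sum_compCoeff hωz hqz (Nat.lt_succ_self n),
      Fin.sum_univ_castSucc, Matrix.mulVec_add, Matrix.mulVec_smul, hx]
    congr 1
    · ext r
      simp [Matrix.mulVec, dotProduct, Dmat, b, mul_comm]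
    · simp [compCoeff_self]
  have hBy : compMat n ω z *ᵥ y = b + deriv ω z ^ (n + 1) • x := by
    refine Matrix.mulVec_injective_of_isUnit
      ((Matrix.isUnit_iff_isUnit_det _).2 (Ne.isUnit hΔ)) ?_
    rw [← hb, ← hy, hD, Matrix.mulVec_mulVec]
  obtain ⟨m, rfl⟩ : ∃ m, n = m + 1 := ⟨n - 1, by omega⟩
  have hlast := congrFun hBy (Fin.last m)
  have hrow : (compMat (m + 1) ω z *ᵥ y) (Fin.last m) =
      deriv ω z ^ (m + 1) * y (Fin.last m) := by
    rw [Matrix.mulVec, dotProduct, Finset.sum_eq_single (Fin.last m)]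
    · simp [compMat, compCoeff_self]
    · intro j _ hj
      have h0 : compMat (m + 1) ω z (Fin.last m) j = 0 :=
        compMat_isUpperTriangular _ ω z (Fin.lt_last_iff_ne_last.2 hj)
      rw [h0, zero_mul]
    · simp
  rw [hrow] at hlast
  have hc := deriv_mul_compCoeff_succ_self hωz (m + 1)
  change y (Fin.last m) = _ + _ * x (Fin.last m)
  simp only [Pi.add_apply, Pi.smul_apply, smul_eq_mul, b, Fin.val_last] at hlast
  refine mul_left_cancel₀ (pow_ne_zero (m + 2) hω') ?_
  calc deriv ω z ^ (m + 2) * y (Fin.last m)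
      = deriv ω z * (deriv ω z ^ (m + 1) * y (Fin.last m)) := by ring
    _ = _ := by
      rw [hlast, mul_add, hc]
      field_simp
      ring
end

section
/- Fix an integer n ≥ 1, let q : V → ℂⁿ be analytic on an open set V ⊆ ℂ, and let ω(z) = (az+b)/(cz+d) be a Möbius transformation (a, b, c, d ∈ ℂ, ad − bc ≠ 0). Then for every integer k ≥ 2 and every z ∈ ℂ with cz + d ≠ 0, ω(z) ∈ V and Δ(q)(ω(z)) ≠ 0, the iterated derivatives of ω satisfy ω^{(k)}(z) = (k!/(n(n+1))^{k−1}) · ω'(z) · (I_n(q ∘ ω)(z) − ω'(z)·I_n(q)(ω(z)))^{k−1}. -/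
/-- Coefficients of the higher chain rule for `(a z + b) / (c z + d)` with determinant `D`:
`(q ∘ ω)⁽ᵏ⁾ = ∑ j, lahCoeff c D k j • (c z + d)⁻¹ ^ (k + j) • q⁽ʲ⁾ ∘ ω`. -/
noncomputable def lahCoeff (c D : ℂ) : ℕ → ℕ → ℂ
  | 0, 0 => 1
  | 0, _ + 1 => 0
  | k + 1, 0 => -c * k * lahCoeff c D k 0
  | k + 1, j + 1 => -c * (k + (j + 1)) * lahCoeff c D k (j + 1) + D * lahCoeff c D k j

lemma lahCoeff_eq_zero_of_lt (c D : ℂ) {k j : ℕ} (hkj : k < j) : lahCoeff c D k j = 0 := by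
  induction k generalizing j with
  | zero => cases j with
    | zero => omega
    | succ j => simp [lahCoeff]
  | succ k ih => cases j with
    | zero => omega
    | succ j => simp [lahCoeff, ih (show k < j + 1 by omega), ih (show k < j by omega)]

lemma lahCoeff_self (c D : ℂ) (k : ℕ) : lahCoeff c D k k = D ^ k := by
  induction k with
  | zero => simp [lahCoeff]
  | succ k ih => simp [lahCoeff, ih, lahCoeff_eq_zero_of_lt c D (Nat.lt_succ_self k), pow_succ']

lemma lahCoeff_succ_self (c D : ℂ) (k : ℕ) :
    lahCoeff c D (k + 1) k = -c * (k * (k + 1)) * D ^ k := by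
  induction k with
  | zero => simp [lahCoeff]
  | succ k ih =>
    rw [lahCoeff, ih, lahCoeff_self]
    push_cast
    ring

lemma lahCoeff_succ_zero (c D : ℂ) (k : ℕ) : lahCoeff c D (k + 1) 0 = 0 := by
  induction k with
  | zero => simp [lahCoeff]
  | succ k ih => rw [lahCoeff, ih, mul_zero]

lemma hasDerivAt_inv_linear_pow (c d : ℂ) {z : ℂ} (hz : c * z + d ≠ 0) (m : ℕ) :
    HasDerivAt (fun z => (c * z + d)⁻¹ ^ m) (-c * m * (c * z + d)⁻¹ ^ (m + 1)) z := by
  have h1 : HasDerivAt (fun z => c * z + d) c z := by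
    simpa using ((hasDerivAt_id z).const_mul c).add_const d
  refine ((h1.fun_inv hz).fun_pow m).congr_deriv ?_
  cases m with
  | zero => simp
  | succ m =>
    simp only [Nat.add_sub_cancel, inv_pow]
    field_simp
    ring

lemma hasDerivAt_moebius {a b c d : ℂ} {ω : ℂ → ℂ}
    (hω : ∀ z, ω z = (a * z + b) / (c * z + d)) {z : ℂ} (hz : c * z + d ≠ 0) :
    HasDerivAt ω ((a * d - b * c) * (c * z + d)⁻¹ ^ 2) z := by
  have h1 (x y : ℂ) : HasDerivAt (fun z => x * z + y) x z := by
    simpa using ((hasDerivAt_id z).const_mul x).add_const y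
  rw [funext hω]
  refine ((h1 a b).fun_div (h1 c d) hz).congr_deriv ?_
  field_simp
  ring

lemma iteratedDeriv_succ_moebius {a b c d : ℂ} {ω : ℂ → ℂ}
    (hω : ∀ z, ω z = (a * z + b) / (c * z + d)) (k : ℕ) {z : ℂ} (hz : c * z + d ≠ 0) :
    iteratedDeriv (k + 1) ω z =
      (k + 1).factorial * (a * d - b * c) * (-c) ^ k * (c * z + d)⁻¹ ^ (k + 2) := by
  induction k generalizing z with
  | zero => simp [(hasDerivAt_moebius hω hz).deriv]
  | succ k ih =>
    have hev : ∀ᶠ w in nhds z, c * w + d ≠ 0 :=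
      (show Continuous fun w => c * w + d by fun_prop).continuousAt.eventually_ne hz
    rw [iteratedDeriv_succ,
      Filter.EventuallyEq.deriv_eq (hev.mono fun w hw => ih hw),
      ((hasDerivAt_inv_linear_pow c d hz (k + 2)).const_mul _).deriv,
      Nat.factorial_succ (k + 1)]
    push_cast
    ring

lemma hasDerivAt_iteratedDeriv {E : Type*} [NormedAddCommGroup E] [NormedSpace ℂ E]
    [CompleteSpace E] {q : ℂ → E} {w : ℂ} (hq : AnalyticAt ℂ q w) (j : ℕ) :
    HasDerivAt (iteratedDeriv j q) (iteratedDeriv (j + 1) q w) w := by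
  rw [iteratedDeriv_succ, iteratedDeriv_eq_iterate]
  exact (hq.iterated_deriv j).differentiableAt.hasDerivAt

lemma iteratedDeriv_comp_moebius {E : Type*} [NormedAddCommGroup E] [NormedSpace ℂ E]
    [CompleteSpace E] {V : Set ℂ} (hV : IsOpen V) {q : ℂ → E} (hq : ∀ w ∈ V, AnalyticAt ℂ q w)
    {a b c d : ℂ} {ω : ℂ → ℂ} (hω : ∀ z, ω z = (a * z + b) / (c * z + d)) (k : ℕ)
    {z : ℂ} (hz : c * z + d ≠ 0) (hzV : ω z ∈ V) :
    iteratedDeriv k (q ∘ ω) z = ∑ j ∈ Finset.range (k + 1),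
      (lahCoeff c (a * d - b * c) k j * (c * z + d)⁻¹ ^ (k + j)) • iteratedDeriv j q (ω z) := by
  induction k generalizing z with
  | zero => simp [lahCoeff]
  | succ k ih =>
    have hev : ∀ᶠ w in nhds z, c * w + d ≠ 0 ∧ ω w ∈ V :=
      ((show Continuous fun w => c * w + d by fun_prop).continuousAt.eventually_ne hz).and
        ((hasDerivAt_moebius hω hz).continuousAt.eventually (hV.mem_nhds hzV))
    have hterm (j : ℕ) := ((hasDerivAt_inv_linear_pow c d hz (k + j)).const_mul
      (lahCoeff c (a * d - b * c) k j)).fun_smul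
      (HasDerivAt.scomp z (hasDerivAt_iteratedDeriv (hq _ hzV) j) (hasDerivAt_moebius hω hz))
    simp only [Function.comp_apply] at hterm
    rw [iteratedDeriv_succ,
      Filter.EventuallyEq.deriv_eq (hev.mono fun w hw => ih hw.1 hw.2),
      (HasDerivAt.fun_sum fun j _ => hterm j).deriv, Finset.sum_range_succ' _ (k + 1),
      Finset.sum_add_distrib]
    have hshift := Finset.sum_range_succ (fun j => (lahCoeff c (a * d - b * c) k j *
      (-c * (k + j : ℕ) * (c * z + d)⁻¹ ^ (k + j + 1))) • iteratedDeriv j q (ω z)) (k + 1)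
    rw [lahCoeff_eq_zero_of_lt c _ k.lt_succ_self, zero_mul, zero_smul, add_zero,
      Finset.sum_range_succ' _ (k + 1)] at hshift
    rw [← hshift, ← add_assoc, ← Finset.sum_add_distrib]
    congr 1
    · refine Finset.sum_congr rfl fun j _ => ?_
      rw [smul_smul, ← add_smul, lahCoeff]
      congr 1
      push_cast
      ring
    · rw [lahCoeff]
      congr 1
      push_cast
      ring

lemma Dmat_mulVec_Iinv {n : ℕ} {u : ℂ → Fin n → ℂ} {z : ℂ} (hΔ : Δmat n u z ≠ 0) :
    (Dmat n u z).mulVec (fun i => Iinv n u i z) = iteratedDeriv (n + 1) u z := by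
  have hI : (fun i => Iinv n u i z) =
      (Δmat n u z)⁻¹ • (Dmat n u z).cramer (iteratedDeriv (n + 1) u z) := by
    ext i
    rw [Pi.smul_apply, Matrix.cramer_apply, smul_eq_mul, Iinv, Ainv, div_eq_inv_mul]
    congr 2
    ext r j
    simp [Matrix.updateCol_apply, Dmat]
  rw [hI, Matrix.mulVec_smul, Matrix.mulVec_cramer, ← Δmat, smul_smul, inv_mul_cancel₀ hΔ,
    one_smul]

/-- The matrix expressing the derivatives of `q ∘ ω` of orders `1, …, n` through those of `q` at `ω z`,
where `s = (c z + d)⁻¹`. -/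
noncomputable def lahMatrix (n : ℕ) (c D s : ℂ) : Matrix (Fin n) (Fin n) ℂ :=
  Matrix.of fun i j => lahCoeff c D (j + 1) (i + 1) * s ^ ((j + 1) + (i + 1) : ℕ)

lemma isUpperTriangular_lahMatrix (n : ℕ) (c D s : ℂ) : (lahMatrix n c D s).IsUpperTriangular := by
  intro i j hij
  have hij' : j < i := hij
  simp [lahMatrix, lahCoeff_eq_zero_of_lt c D (show (j : ℕ) + 1 < i + 1 by omega)]

lemma det_lahMatrix_ne_zero (n : ℕ) (c : ℂ) {D s : ℂ} (hD : D ≠ 0) (hs : s ≠ 0) :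
    (lahMatrix n c D s).det ≠ 0 := by
  rw [Matrix.det_of_isUpperTriangular (isUpperTriangular_lahMatrix n c D s),
    Finset.prod_ne_zero_iff]
  intro i _
  simp only [lahMatrix, Matrix.of_apply, lahCoeff_self]
  exact mul_ne_zero (pow_ne_zero _ hD) (pow_ne_zero _ hs)

lemma iteratedDeriv_succ_comp_moebius_apply
    {n : ℕ} {V : Set ℂ} (hV : IsOpen V) {q : ℂ → Fin n → ℂ} (hq : ∀ w ∈ V, AnalyticAt ℂ q w)
    {a b c d : ℂ} {ω : ℂ → ℂ} (hω : ∀ z, ω z = (a * z + b) / (c * z + d))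
    {z : ℂ} (hz : c * z + d ≠ 0) (hzV : ω z ∈ V)
    (k : ℕ) (r : Fin n) :
    iteratedDeriv (k + 1) (q ∘ ω) z r = ∑ j ∈ Finset.range (k + 1),
      iteratedDeriv (j + 1) q (ω z) r *
        (lahCoeff c (a * d - b * c) (k + 1) (j + 1) * (c * z + d)⁻¹ ^ ((k + 1) + (j + 1))) := by
  rw [iteratedDeriv_comp_moebius hV hq hω (k + 1) hz hzV, Finset.sum_range_succ',
    lahCoeff_succ_zero]
  simp [mul_comm]

lemma Dmat_comp_moebius
    {n : ℕ} {V : Set ℂ} (hV : IsOpen V) {q : ℂ → Fin n → ℂ} (hq : ∀ w ∈ V, AnalyticAt ℂ q w)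
    {a b c d : ℂ} {ω : ℂ → ℂ} (hω : ∀ z, ω z = (a * z + b) / (c * z + d))
    {z : ℂ} (hz : c * z + d ≠ 0) (hzV : ω z ∈ V) :
    Dmat n (q ∘ ω) z = Dmat n q (ω z) * lahMatrix n c (a * d - b * c) (c * z + d)⁻¹ := by
  ext r j
  rw [Dmat, Matrix.of_apply, iteratedDeriv_succ_comp_moebius_apply hV hq hω hz hzV,
    Matrix.mul_apply]
  simp only [Dmat, lahMatrix, Matrix.of_apply]
  rw [Fin.sum_univ_eq_sum_range (fun i => iteratedDeriv (i + 1) q (ω z) r *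
    (lahCoeff c (a * d - b * c) (j + 1) (i + 1) * (c * z + d)⁻¹ ^ (((j : ℕ) + 1) + (i + 1)))) n]
  refine Finset.sum_subset (fun i hi => ?_) fun i _ hi => ?_
  · simp only [Finset.mem_range] at hi ⊢
    omega
  · rw [Finset.mem_range, not_lt] at hi
    rw [lahCoeff_eq_zero_of_lt c _ (show (j : ℕ) + 1 < i + 1 by omega), zero_mul, mul_zero]

lemma Iinv_comp_moebius_last
    {n : ℕ} {V : Set ℂ} (hV : IsOpen V) {q : ℂ → Fin n → ℂ} (hq : ∀ w ∈ V, AnalyticAt ℂ q w)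
    {a b c d : ℂ} {ω : ℂ → ℂ} (hω : ∀ z, ω z = (a * z + b) / (c * z + d))
    {z : ℂ} (hz : c * z + d ≠ 0) (hzV : ω z ∈ V)
    (hn : 1 ≤ n) (hD : a * d - b * c ≠ 0) (hΔ : Δmat n q (ω z) ≠ 0) :
    Iinv n (q ∘ ω) ⟨n - 1, by omega⟩ z =
      (a * d - b * c) * (c * z + d)⁻¹ ^ 2 * Iinv n q ⟨n - 1, by omega⟩ (ω z) -
        c * (n * (n + 1)) * (c * z + d)⁻¹ := by
  set D := a * d - b * c
  set s := (c * z + d)⁻¹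
  have hs0 : s ≠ 0 := inv_ne_zero hz
  set T := lahMatrix n c D s
  have hmul : Dmat n (q ∘ ω) z = Dmat n q (ω z) * T := Dmat_comp_moebius hV hq hω hz hzV
  have hΔ' : Δmat n (q ∘ ω) z ≠ 0 := by
    rw [Δmat, hmul, Matrix.det_mul]
    exact mul_ne_zero hΔ (det_lahMatrix_ne_zero n c hD hs0)
  set x := fun i => Iinv n q i (ω z)
  set y := fun i => Iinv n (q ∘ ω) i z
  set t : Fin n → ℂ := fun i => lahCoeff c D (n + 1) (i + 1) * s ^ ((n + 1) + (i + 1) : ℕ) with ht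
  have hnext : iteratedDeriv (n + 1) (q ∘ ω) z =
      (Dmat n q (ω z)).mulVec (t + (D ^ (n + 1) * s ^ (2 * n + 2)) • x) := by
    rw [Matrix.mulVec_add, Matrix.mulVec_smul, Dmat_mulVec_Iinv hΔ]
    ext r
    rw [iteratedDeriv_succ_comp_moebius_apply hV hq hω hz hzV, Finset.sum_range_succ,
      lahCoeff_self, ← Fin.sum_univ_eq_sum_range (fun i => iteratedDeriv (i + 1) q (ω z) r *
        (lahCoeff c D (n + 1) (i + 1) * s ^ ((n + 1) + (i + 1) : ℕ))) n]
    simp only [Pi.add_apply, Pi.smul_apply, smul_eq_mul, Matrix.mulVec, dotProduct, Dmat,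
      Matrix.of_apply, ht]
    ring
  have hTy : T.mulVec y = t + (D ^ (n + 1) * s ^ (2 * n + 2)) • x := by
    refine Matrix.mulVec_injective_of_isUnit
      ((Matrix.isUnit_iff_isUnit_det _).2 (isUnit_iff_ne_zero.2 hΔ)) ?_
    rw [← hnext, Matrix.mulVec_mulVec, ← hmul, Dmat_mulVec_Iinv hΔ']
  set l : Fin n := ⟨n - 1, by omega⟩ with hl
  have hl1 : (l : ℕ) + 1 = n := by simp only [hl]; omega
  have hrow := congrFun hTy l
  rw [Matrix.mulVec, dotProduct, Finset.sum_eq_single l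
    (fun j _ hj => by
      have hjl : j < l := by
        rw [Fin.lt_def]
        have := Fin.val_ne_of_ne hj
        omega
      have hT : T l j = 0 := isUpperTriangular_lahMatrix n c D s hjl
      rw [hT, zero_mul])
    (fun hmem => absurd (Finset.mem_univ l) hmem)] at hrow
  simp only [T, lahMatrix, Matrix.of_apply, hl1, lahCoeff_self, Pi.add_apply, ht,
    lahCoeff_succ_self, Pi.smul_apply, smul_eq_mul] at hrow
  refine mul_left_cancel₀ (mul_ne_zero (pow_ne_zero n hD) (pow_ne_zero (n + n) hs0)) ?_
  linear_combination hrow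

/-- Corollary `comCor2`: for a Möbius transformation `ω` and `k ≥ 2`,
`ω⁽ᵏ⁾ = (k!/(n(n+1))^(k-1))·ω'·(I_n(q∘ω) − ω'·I_n(q)∘ω)^(k-1)`. -/
theorem moebius_derivatives_via_In (n : ℕ) (hn : 1 ≤ n) (V : Set ℂ) (hV : IsOpen V)
    (q : ℂ → (Fin n → ℂ)) (hq : ∀ w ∈ V, AnalyticAt ℂ q w)
    (a b c d : ℂ) (h : a * d - b * c ≠ 0)
    (ω : ℂ → ℂ) (hω : ∀ z, ω z = (a * z + b) / (c * z + d))
    (k : ℕ) (hk : 2 ≤ k) (z : ℂ) (hz : c * z + d ≠ 0)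
    (hzV : ω z ∈ V) (hΔ : Δmat n q (ω z) ≠ 0) :
    iteratedDeriv k ω z =
      (k.factorial : ℂ) / (n * (n + 1) : ℂ) ^ (k - 1) * deriv ω z *
        (Iinv n (q ∘ ω) ⟨n - 1, by omega⟩ z -
          deriv ω z * Iinv n q ⟨n - 1, by omega⟩ (ω z)) ^ (k - 1) := by
  have hD := (hasDerivAt_moebius hω hz).deriv
  obtain ⟨m, rfl⟩ : ∃ m, k = m + 1 := ⟨k - 1, by omega⟩
  have hn0 : (n : ℂ) ≠ 0 := Nat.cast_ne_zero.2 (by omega)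
  have hn1 : (n + 1 : ℂ) ≠ 0 := Nat.cast_add_one_ne_zero n
  rw [iteratedDeriv_succ_moebius hω m hz, Iinv_comp_moebius_last hV hq hω hz hzV hn h hΔ, hD,
    Nat.add_sub_cancel, sub_sub_cancel_left,
    show -(c * (n * (n + 1)) * (c * z + d)⁻¹) = n * (n + 1) * (-c * (c * z + d)⁻¹) by ring,
    mul_pow (n * (n + 1) : ℂ), mul_pow (-c)]
  have hpow : (n * (n + 1) : ℂ) ^ m ≠ 0 := pow_ne_zero _ (mul_ne_zero hn0 hn1)
  rw [div_mul_eq_mul_div, div_mul_eq_mul_div, eq_div_iff hpow]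
  ring
end

section
/- Fix integers n ≥ 2 and 1 ≤ i ≤ n−1, and set s := n−i+1. Define rational numbers B̃_{k,m} := binom(k−1, m−1)·(k!/m!)/(n(n+1))^{k−m} for k ≥ m ≥ 1, and B̃_{k,m} := 0 for k < m (note B̃_{k,k} = 1). Let M be the s×s matrix whose rows are indexed, from top to bottom, by k = n+1, n, n−1, …, i+1, and whose columns carry, from left to right, the second indices n+1, n−1, n−2, …, i, with entry B̃_{k,m} in row k and column with second index m; let M' be the s×s matrix with the same row indices but with column second indices n, n−1, …, i. Then det M = (n−i+1) · det M'. -/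
/-- `B̃_{k,m} := C(k−1,m−1)·(k!/m!)/(n(n+1))^(k−m)` for `k ≥ m`, and `0` for `k < m`. -/
noncomputable def Btilde (n : ℕ) (k m : ℕ) : ℚ :=
  if m ≤ k then
    ((k - 1).choose (m - 1) : ℚ) * (k.factorial : ℚ) / (m.factorial : ℚ) /
      (n * (n + 1) : ℚ) ^ (k - m)
  else 0

/-- Trinomial revision for `Btilde`. -/
lemma Btilde_mul_Btilde (n : ℕ) {i k m : ℕ} (hi : 1 ≤ i) (him : i ≤ m) (hik : i ≤ k) :
    Btilde n k m * Btilde n m i = Btilde n k i * ((k - i).choose (m - i) : ℚ) := by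
  unfold Btilde
  rcases lt_or_ge k m with h | h
  · rw [if_neg h.not_ge, Nat.choose_eq_zero_of_lt (show k - i < m - i by omega)]
    simp
  · rw [if_pos h, if_pos him, if_pos hik]
    have hpow : (n * (n + 1) : ℚ) ^ (k - i) =
        (n * (n + 1) : ℚ) ^ (k - m) * (n * (n + 1) : ℚ) ^ (m - i) := by
      rw [← pow_add]
      congr 1
      omega
    have hchoose : ((k - 1).choose (m - 1) : ℚ) * ((m - 1).choose (i - 1) : ℚ) =
        ((k - 1).choose (i - 1) : ℚ) * ((k - i).choose (m - i) : ℚ) := by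
      have := Nat.choose_mul (n := k - 1) (k := m - 1) (s := i - 1) (by omega)
      rw [show k - 1 - (i - 1) = k - i by omega, show m - 1 - (i - 1) = m - i by omega] at this
      exact_mod_cast this
    have hm : (m.factorial : ℚ) ≠ 0 := by positivity
    rw [hpow]
    calc _ = (((k - 1).choose (m - 1) : ℚ) * ((m - 1).choose (i - 1) : ℚ)) * k.factorial /
          i.factorial / ((n * (n + 1) : ℚ) ^ (k - m) * (n * (n + 1) : ℚ) ^ (m - i)) *
          (m.factorial / m.factorial) := by ring
      _ = _ := by rw [hchoose, div_self hm]; ring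

lemma sum_range_alternating_choose_sub (K d : ℕ) :
    ∑ c ∈ Finset.range (d + 1), (-1 : ℚ) ^ c * ((K + 1).choose (d - c) : ℚ) = K.choose d := by
  induction d with
  | zero => simp
  | succ d ih =>
    rw [Finset.sum_range_succ']
    simp only [Nat.add_sub_add_right, pow_succ, mul_neg, mul_one, neg_mul,
      Finset.sum_neg_distrib, ih]
    simp [Nat.choose_succ_succ]

lemma Btilde_ne_zero {n k m : ℕ} (hn : n ≠ 0) (hmk : m ≤ k) : Btilde n k m ≠ 0 := by
  have : 0 < (k - 1).choose (m - 1) := Nat.choose_pos (by omega)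
  have : 0 < n := Nat.pos_of_ne_zero hn
  rw [Btilde, if_pos hmk]
  positivity

lemma Btilde_eq_mul_Btilde_succ {n i : ℕ} (hi : 1 ≤ i) (hin : i ≤ n) :
    Btilde n n i = ((n : ℚ) - i + 1) * Btilde n (n + 1) i := by
  obtain ⟨j, rfl⟩ := Nat.exists_eq_add_of_le' hi
  obtain ⟨d, rfl⟩ := Nat.exists_eq_add_of_le hin
  have hchoose : ((j + 1 + d).choose j : ℚ) * (d + 1) = (j + d).choose j * (j + 1 + d) := by
    have := Nat.choose_mul_succ_eq (j + d) j
    rw [show j + d + 1 - j = d + 1 by omega, show j + d + 1 = j + 1 + d by omega] at this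
    exact_mod_cast this.symm
  have hpow : j + 1 + d + 1 - (j + 1) = d + 1 := by omega
  simp only [Btilde, if_pos hin, if_pos (hin.trans (Nat.le_succ _)), hpow, Nat.factorial_succ,
    Nat.add_sub_cancel, Nat.add_sub_cancel_left, show j + 1 + d - 1 = j + d by omega]
  have hne : ((j : ℚ) + 1 + d) ≠ 0 := by positivity
  have hne' : (((j + 1 + d : ℕ) : ℚ) * ((j + 1 + d : ℕ) + 1)) ^ d ≠ 0 := by positivity
  rw [pow_succ]
  generalize (((j + 1 + d : ℕ) : ℚ) * ((j + 1 + d : ℕ) + 1)) ^ d = P at hne' ⊢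
  push_cast
  field_simp
  linear_combination (-1 : ℚ) * hchoose

/-- The column of index `n + 1` is a combination of those of indices `n, …, i` in rows `> i`. -/
lemma Btilde_succ_mul_eq_sum {n i k : ℕ} (hi : 1 ≤ i) (hin : i ≤ n) (hik : i < k)
    (hkn : k ≤ n + 1) :
    Btilde n k (n + 1) * Btilde n (n + 1) i =
      ∑ c ∈ Finset.range (n - i + 1), (-1) ^ c * (Btilde n k (n - c) * Btilde n (n - c) i) := by
  have hterm : ∀ c ∈ Finset.range (n - i + 1),
      (-1) ^ c * (Btilde n k (n - c) * Btilde n (n - c) i) =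
        Btilde n k i * ((-1) ^ c * ((k - i - 1 + 1).choose (n - i - c) : ℚ)) := by
    intro c hc
    rw [Finset.mem_range] at hc
    rw [Btilde_mul_Btilde n hi (by omega) hik.le, show n - c - i = n - i - c by omega,
      show k - i - 1 + 1 = k - i by omega]
    ring
  rw [Finset.sum_congr rfl hterm, ← Finset.mul_sum, sum_range_alternating_choose_sub,
    Btilde_mul_Btilde n hi (by omega) hik.le]
  congr 2
  rcases hkn.eq_or_lt with rfl | h
  · rw [show n + 1 - i - 1 = n - i by omega]
    simp
  · rw [Nat.choose_eq_zero_of_lt (by omega), Nat.choose_eq_zero_of_lt (by omega)]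

/-- Lemma `comLem5`: `M_{n−i}^{n+1,i+1} = (n−i+1)·M_{n−i+1}^{n+1,i+1}`.
Both matrices are `s×s` with `s = n−i+1`, rows indexed (top to bottom) by
`k = n+1, n, …, i+1`; the columns of `M` carry the second indices `n+1, n−1, n−2, …, i`
and those of `M'` the second indices `n, n−1, …, i`. -/
theorem det_M_eq_det_M' (n i : ℕ) (hn : 2 ≤ n) (hi1 : 1 ≤ i) (hi2 : i ≤ n - 1) :
    (Matrix.of fun (r c : Fin (n - i + 1)) =>
        Btilde n (n + 1 - r.1) (if c.1 = 0 then n + 1 else n - c.1)).det =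
      ((n : ℚ) - i + 1) *
        (Matrix.of fun (r c : Fin (n - i + 1)) => Btilde n (n + 1 - r.1) (n - c.1)).det := by
  set M' : Matrix (Fin (n - i + 1)) (Fin (n - i + 1)) ℚ :=
    Matrix.of fun r c => Btilde n (n + 1 - r.1) (n - c.1) with hM'
  have hne : Btilde n (n + 1) i ≠ 0 := Btilde_ne_zero (by omega) (by omega)
  let a : Fin (n - i + 1) → ℚ := fun c => (-1) ^ c.1 * Btilde n (n - c.1) i / Btilde n (n + 1) i
  have ha : a 0 = (n : ℚ) - i + 1 := by
    simp only [a, Fin.val_zero, pow_zero, one_mul, Nat.sub_zero]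
    rw [Btilde_eq_mul_Btilde_succ hi1 (by omega), mul_div_cancel_right₀ _ hne]
  rw [← ha, ← smul_eq_mul, ← Matrix.det_updateCol_sum]
  congr 1
  ext r c
  rcases eq_or_ne c 0 with rfl | hc
  · have hsum := Btilde_succ_mul_eq_sum (n := n) (k := n + 1 - r.1) hi1 (by omega) (by omega)
      (by omega)
    simp only [Matrix.of_apply, Fin.val_zero, if_true, Matrix.updateCol_self, smul_eq_mul, a, hM']
    rw [eq_div_of_mul_eq hne hsum, ← Fin.sum_univ_eq_sum_range
      (fun c => (-1) ^ c * (Btilde n (n + 1 - r.1) (n - c) * Btilde n (n - c) i)),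
      Finset.sum_div]
    exact Finset.sum_congr rfl fun c _ => by ring
  · have hc' : c.1 ≠ 0 := fun h => hc (Fin.ext h)
    rw [Matrix.updateCol_ne hc]
    simp [hM', hc]
end
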